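/- (Theorem 1.2, second identity.) If M is a positive integer with M ≡ 1 (mod 8) and 7 | M, then 7·(1,8,8,0,0,0)(M/7²) = −(1,14,14,0,0,0)(M) − 2·(2,7,14,0,0,0)(M) + 4·(3,5,14,0,0,2)(M), where (1,8,8,0,0,0)(M/7²) is understood to be 0 when 7² does not divide M. -/

import Mathlib

/-- The number of representations of `M` by the ternary quadratic form
`a x² + b y² + c z² + d y z + e z x + f x y`. -/
noncomputable def rep (a b c d e f M : ℤ) : ℕ :=
  {p : ℤ × ℤ × ℤ | M = a * p.1 ^ 2 + b * p.2.1 ^ 2 + c * p.2.2 ^ 2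
      + d * p.2.1 * p.2.2 + e * p.2.2 * p.1 + f * p.1 * p.2.1}.ncard

namespace T7
open PowerSeries

abbrev R := PowerSeries ℚ

structure Good {ι : Type*} (Q : ι → ℤ) : Prop where
  nn : ∀ i, 0 ≤ Q i
  fin : ∀ n : ℤ, {i | Q i = n}.Finite

noncomputable def Th {ι : Type*} (Q : ι → ℤ) (w : ι → ℚ) : R :=
  PowerSeries.mk fun n => ∑ᶠ i ∈ {i | Q i = (n : ℤ)}, w i

theorem coeff_Th {ι : Type*} (Q : ι → ℤ) (w : ι → ℚ) (n : ℕ) :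
    coeff n (Th Q w) = ∑ᶠ i ∈ {i | Q i = (n : ℤ)}, w i := by simp [Th]

theorem coeff_Th_fin {ι : Type*} {Q : ι → ℤ} (h : Good Q) (w : ι → ℚ) (n : ℕ) :
    coeff n (Th Q w) = ∑ i ∈ (h.fin n).toFinset, w i := by
  rw [coeff_Th, finsum_mem_eq_finite_toFinset_sum]

theorem coeff_Th_one {ι : Type*} {Q : ι → ℤ} (h : Good Q) (n : ℕ) :
    coeff n (Th Q (fun _ => 1)) = ({i | Q i = (n : ℤ)}.ncard : ℚ) := by
  rw [coeff_Th_fin h, Set.ncard_eq_toFinset_card _ (h.fin n)]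
  simp

theorem Good.comp {ι κ : Type*} {Q : ι → ℤ} (h : Good Q) {f : κ → ι} (hf : f.Injective) :
    Good (fun k => Q (f k)) :=
  ⟨fun _ => h.nn _, fun n => (h.fin n).preimage hf.injOn⟩

theorem Good.congr {ι : Type*} {Q Q' : ι → ℤ} (h : Good Q) (hq : ∀ i, Q' i = Q i) : Good Q' := by
  have : Q' = Q := funext hq
  rwa [this]

theorem Good.smul {ι : Type*} {Q : ι → ℤ} (h : Good Q) {m : ℤ} (hm : 0 < m) :
    Good (fun i => m * Q i) := by
  refine ⟨fun i => mul_nonneg hm.le (h.nn i), fun n => ?_⟩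
  refine (h.fin (n / m)).subset ?_
  intro i hi
  simp only [Set.mem_ofPred_eq] at hi ⊢
  rw [← hi, Int.mul_ediv_cancel_left _ hm.ne']

theorem Good.prod {ι κ : Type*} {P : ι → ℤ} {Q : κ → ℤ} (hP : Good P) (hQ : Good Q) :
    Good (fun x : ι × κ => P x.1 + Q x.2) := by
  refine ⟨fun i => add_nonneg (hP.nn _) (hQ.nn _), fun n => ?_⟩
  have h1 : (⋃ k ∈ Set.Icc (0:ℤ) n, {i | P i = k}).Finite :=
    (Set.finite_Icc _ _).biUnion (fun k _ => hP.fin k)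
  have h2 : (⋃ k ∈ Set.Icc (0:ℤ) n, {i | Q i = k}).Finite :=
    (Set.finite_Icc _ _).biUnion (fun k _ => hQ.fin k)
  refine (h1.prod h2).subset ?_
  rintro ⟨i, k⟩ h
  have := hP.nn i
  have := hQ.nn k
  simp only [Set.mem_ofPred_eq] at h
  simp only [Set.mem_prod, Set.mem_iUnion, Set.mem_ofPred_eq, Set.mem_Icc]
  exact ⟨⟨_, ⟨by omega, by omega⟩, rfl⟩, ⟨_, ⟨by omega, by omega⟩, rfl⟩⟩

theorem Th_congr {ι : Type*} {Q Q' : ι → ℤ} {w w' : ι → ℚ} (hq : ∀ i, Q i = Q' i)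
    (hw : ∀ i, w i = w' i) : Th Q w = Th Q' w' := by
  rw [funext hq, funext hw]

theorem Th_bij {ι κ : Type*} {Q : ι → ℤ} {w : ι → ℚ} {Q' : κ → ℤ} {w' : κ → ℚ} (f : κ → ι)
    (hf : f.Bijective) (hq : ∀ k, Q (f k) = Q' k) (hw : ∀ k, w (f k) = w' k) :
    Th Q w = Th Q' w' := by
  ext n
  rw [coeff_Th, coeff_Th]
  symm
  refine finsum_mem_eq_of_bijOn f ⟨?_, hf.1.injOn, ?_⟩ (fun k _ => (hw k).symm)
  · intro k hk
    simp only [Set.mem_ofPred_eq] at hk ⊢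
    rw [hq, hk]
  · intro i hi
    obtain ⟨k, rfl⟩ := hf.2 i
    exact ⟨k, by simpa [hq] using hi, rfl⟩

theorem Th_add {ι : Type*} {Q : ι → ℤ} (h : Good Q) (w w' : ι → ℚ) :
    Th Q w + Th Q w' = Th Q (fun i => w i + w' i) := by
  ext n
  rw [map_add, coeff_Th_fin h, coeff_Th_fin h, coeff_Th_fin h, Finset.sum_add_distrib]

theorem Th_smul {ι : Type*} {Q : ι → ℤ} (h : Good Q) (c : ℚ) (w : ι → ℚ) :
    C c * Th Q w = Th Q (fun i => c * w i) := by
  ext n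
  rw [coeff_C_mul, coeff_Th_fin h, coeff_Th_fin h, Finset.mul_sum]

theorem Th_sum {ι κ : Type*} {Q : ι ⊕ κ → ℤ} (h : Good Q) (w : ι ⊕ κ → ℚ) :
    Th Q w = Th (fun i => Q (.inl i)) (fun i => w (.inl i)) +
      Th (fun i => Q (.inr i)) (fun i => w (.inr i)) := by
  ext n
  rw [map_add, coeff_Th_fin h, coeff_Th_fin (h.comp Sum.inl_injective),
    coeff_Th_fin (h.comp Sum.inr_injective)]
  have : (h.fin n).toFinset = ((h.comp Sum.inl_injective).fin n).toFinset.disjSum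
      ((h.comp Sum.inr_injective).fin n).toFinset := by
    ext (x | x) <;> simp
  rw [this, Finset.sum_disjSum]

theorem Th_split {ι κ l : Type*} {Q : ι → ℤ} (h : Good Q) (w : ι → ℚ) (f : κ → ι) (g : l → ι)
    (hb : (Sum.elim f g).Bijective) :
    Th Q w = Th (fun i => Q (f i)) (fun i => w (f i)) +
      Th (fun i => Q (g i)) (fun i => w (g i)) := by
  have h1 : Th Q w = Th (fun i => Q (Sum.elim f g i)) (fun i => w (Sum.elim f g i)) :=
    Th_bij (Sum.elim f g) hb (fun _ => rfl) (fun _ => rfl)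
  rw [h1, Th_sum (h.comp hb.1)]
  rfl

theorem Th_X {ι : Type*} {Q : ι → ℤ} (h : Good Q) (w : ι → ℚ) (m : ℕ) :
    X ^ m * Th Q w = Th (fun i => Q i + m) w := by
  ext n
  rw [coeff_X_pow_mul']
  split_ifs with hm
  · rw [coeff_Th, coeff_Th]
    have : {i | Q i = ((n - m : ℕ) : ℤ)} = {i | Q i + m = (n : ℤ)} := by
      ext i; simp only [Set.mem_ofPred_eq]; omega
    rw [this]
  · have : {i | Q i + m = (n : ℤ)} = ∅ := by
      ext i
      have := h.nn i
      simp only [Set.mem_ofPred_eq, Set.mem_empty_iff_false, iff_false]; omega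
    rw [coeff_Th, this, finsum_mem_empty]

theorem Th_mul {ι κ : Type*} {P : ι → ℤ} {Q : κ → ℤ} (hP : Good P) (hQ : Good Q)
    (w : ι → ℚ) (w' : κ → ℚ) :
    Th P w * Th Q w' = Th (fun x : ι × κ => P x.1 + Q x.2) (fun x => w x.1 * w' x.2) := by
  classical
  ext n
  rw [coeff_mul, coeff_Th_fin (hP.prod hQ)]
  rw [← Finset.sum_fiberwise_of_maps_to (t := Finset.HasAntidiagonal.antidiagonal n)
    (g := fun x : ι × κ => ((P x.1).toNat, (Q x.2).toNat))]
  · refine Finset.sum_congr rfl ?_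
    rintro ⟨a, b⟩ hab
    rw [Finset.HasAntidiagonal.mem_antidiagonal] at hab
    simp only at hab ⊢
    rw [coeff_Th_fin hP, coeff_Th_fin hQ, Finset.sum_mul_sum, ← Finset.sum_product']
    refine Finset.sum_congr ?_ (fun _ _ => rfl)
    ext ⟨i, k⟩
    have := hP.nn i
    have := hQ.nn k
    simp only [Finset.mem_product, Set.Finite.mem_toFinset, Set.mem_ofPred_eq, Finset.mem_filter,
      Prod.mk.injEq]
    omega
  · rintro ⟨i, k⟩ h
    have := hP.nn i
    have := hQ.nn k
    simp only [Set.Finite.mem_toFinset, Set.mem_ofPred_eq, Finset.HasAntidiagonal.mem_antidiagonal] at h ⊢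
    omega

/-- `q d/dq` -/
noncomputable def D : Derivation ℚ R R := (X : R) • (PowerSeries.derivative ℚ)

theorem coeff_D (f : R) (n : ℕ) : coeff n (D f) = n * coeff n f := by
  simp only [D, Derivation.smul_apply, smul_eq_mul]
  cases n with
  | zero => simp
  | succ n =>
    rw [coeff_succ_X_mul, PowerSeries.coeff_derivative]; push_cast; ring

theorem D_Th {ι : Type*} {Q : ι → ℤ} (h : Good Q) (w : ι → ℚ) :
    D (Th Q w) = Th Q (fun i => Q i * w i) := by
  ext n
  rw [coeff_D, coeff_Th_fin h, coeff_Th_fin h, Finset.mul_sum]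
  refine Finset.sum_congr rfl fun i hi => ?_
  simp only [Set.Finite.mem_toFinset, Set.mem_ofPred_eq] at hi
  rw [hi]; simp

theorem good_Z {Q : ℤ → ℤ} (h0 : ∀ x, 0 ≤ Q x) (h : ∀ x, x ^ 2 ≤ 4 * Q x + 4) : Good Q := by
  refine ⟨h0, fun n => (Set.finite_Icc (-(4 * n + 4)) (4 * n + 4)).subset ?_⟩
  intro x hx
  simp only [Set.mem_ofPred_eq] at hx
  have := h x
  rw [hx] at this
  constructor <;> nlinarith

theorem good_Z2 {Q : ℤ × ℤ → ℤ} (h0 : ∀ x, 0 ≤ Q x) (h : ∀ x, x.1 ^ 2 ≤ 4 * Q x + 4)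
    (h' : ∀ x, x.2 ^ 2 ≤ 4 * Q x + 4) : Good Q := by
  refine ⟨h0, fun n => ((Set.finite_Icc (-(4 * n + 4)) (4 * n + 4)).prod
    (Set.finite_Icc (-(4 * n + 4)) (4 * n + 4))).subset ?_⟩
  intro x hx
  simp only [Set.mem_ofPred_eq] at hx
  have h1 := h x
  have h2 := h' x
  rw [hx] at h1 h2
  refine ⟨⟨?_, ?_⟩, ⟨?_, ?_⟩⟩ <;> nlinarith

def sg (x : ℤ) : ℚ := if x % 2 = 0 then 1 else -1

theorem sg_add (x y : ℤ) : sg x * sg y = sg (x + y) := by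
  unfold sg
  rcases Int.emod_two_eq_zero_or_one x with h | h <;>
    rcases Int.emod_two_eq_zero_or_one y with h' | h' <;>
    simp [Int.add_emod, h, h']

noncomputable def ph (m : ℕ) : R := Th (fun x : ℤ => (m:ℤ) * x ^ 2) (fun _ => 1)
noncomputable def pm (m : ℕ) : R := Th (fun x : ℤ => (m:ℤ) * x ^ 2) sg
noncomputable def ps (m : ℕ) : R := Th (fun x : ℤ => (m:ℤ) * (2 * x ^ 2 + x)) (fun _ => 1)
noncomputable def J (m : ℕ) : R := Th (fun x : ℤ => (m:ℤ) * (2 * x ^ 2 + x)) (fun x => 4 * x + 1)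

theorem good_ph {m : ℕ} (hm : 0 < m) : Good (fun x : ℤ => (m:ℤ) * x ^ 2) :=
  (good_Z (Q := fun x => x ^ 2) (fun x => by positivity) (fun x => by nlinarith)).smul (by omega)

theorem tri_nn (x : ℤ) : 0 ≤ 2 * x ^ 2 + x := by
  rcases le_or_gt 0 x with h | h <;> nlinarith

theorem good_ps {m : ℕ} (hm : 0 < m) : Good (fun x : ℤ => (m:ℤ) * (2 * x ^ 2 + x)) :=
  (good_Z (Q := fun x => 2 * x ^ 2 + x) tri_nn
    (fun x => by nlinarith)).smul (by omega)

end T7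

namespace T7
open PowerSeries

noncomputable def qp (m n : ℕ) : R := ∏ i ∈ Finset.range n, (1 + C (-1) * X ^ (m * i + m))

noncomputable def iq (m : ℕ) (n : ℤ) : R := if n < 0 then 0 else (qp m n.toNat)⁻¹

theorem qp_cc {m : ℕ} (hm : 0 < m) (n : ℕ) : constantCoeff (qp m n) = 1 := by
  unfold qp
  rw [map_prod]
  refine Finset.prod_eq_one fun i _ => ?_
  simp only [map_add, map_mul, map_pow, map_one, constantCoeff_X]
  rw [zero_pow (by positivity)]; simp

theorem qp_succ (m n : ℕ) : qp m (n + 1) = qp m n * (1 - (X ^ m) * (X ^ m) ^ n) := by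
  unfold qp
  rw [Finset.prod_range_succ, ← pow_mul, pow_add]
  simp only [map_neg, map_one]; ring

theorem qp_iq {m : ℕ} (hm : 0 < m) (n : ℕ) : qp m n * iq m n = 1 := by
  unfold iq
  rw [if_neg (by omega), Int.toNat_natCast]
  exact PowerSeries.mul_inv_cancel _ (by rw [qp_cc hm]; exact one_ne_zero)

theorem iq_neg (m : ℕ) {n : ℤ} (h : n < 0) : iq m n = 0 := by simp [iq, h]

theorem iq_succ {m : ℕ} (hm : 0 < m) (n : ℕ) :
    iq m n = (1 - (X ^ m) * (X ^ m) ^ n) * iq m (n + 1 : ℤ) := by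
  have h1 := qp_iq hm n
  have h2 := qp_iq hm (n + 1)
  rw [qp_succ] at h2
  push_cast at h2
  linear_combination (-iq m n) * h2 + (1 - (X ^ m) * (X ^ m) ^ n) * iq m (n + 1 : ℤ) * h1

theorem iq_pred {m : ℕ} (hm : 0 < m) (n : ℕ) :
    iq m ((n : ℤ) - 1) = (1 - (X ^ m) ^ n) * iq m n := by
  cases n with
  | zero => rw [iq_neg]; simp; simp
  | succ n =>
    have := iq_succ hm n
    push_cast
    rw [show (n : ℤ) + 1 - 1 = n by ring, this]; ring

noncomputable def cc (m N : ℕ) (k : ℤ) : R := qp m (2 * N) * iq m (N + k) * iq m (N - k)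

theorem cc_zero (m N : ℕ) (k : ℤ) (h : k < -N ∨ N < k) : cc m N k = 0 := by
  unfold cc
  rcases h with h | h
  · rw [iq_neg m (show (N:ℤ) + k < 0 by omega)]; ring
  · rw [iq_neg m (show (N:ℤ) - k < 0 by omega)]; ring

theorem cc_self {m : ℕ} (hm : 0 < m) (N : ℕ) : cc m N N = 1 := by
  unfold cc
  have h1 := qp_iq hm (2 * N)
  have h2 := qp_iq hm 0
  rw [show ((2 * N : ℕ) : ℤ) = N + N by push_cast; ring] at h1
  rw [h1, sub_self, one_mul]
  simpa [qp] using h2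

theorem cc_symm (m N : ℕ) (k : ℤ) : cc m N (-k) = cc m N k := by
  unfold cc
  rw [show (N:ℤ) + -k = N - k by ring, show (N:ℤ) - -k = N + k by ring]; ring

theorem cc_rec {m : ℕ} (hm : 0 < m) (N : ℕ) (k : ℤ) (h1 : -(N + 1 : ℤ) ≤ k) (h2 : k ≤ N + 1) :
    cc m (N + 1) k = (1 + (X ^ m) ^ (2 * N + 1)) * cc m N k
      + (X ^ m) ^ (N + 1 - k).toNat * cc m N (k - 1)
      + (X ^ m) ^ (N + 1 + k).toNat * cc m N (k + 1) := by
  rcases eq_or_lt_of_le h2 with h | h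
  · subst h
    have := cc_self hm (N + 1)
    push_cast at this
    rw [this, cc_zero m N (N + 1) (by omega), cc_zero m N (N + 1 + 1) (by omega),
      show (N:ℤ) + 1 - 1 = N by ring, cc_self hm]
    simp
  rcases eq_or_lt_of_le h1 with h' | h'
  · subst h'
    have := cc_self hm (N + 1)
    push_cast at this
    rw [show -(N + 1 : ℤ) - 1 = -(N + 2) by ring, show -(N + 1 : ℤ) + 1 = -N by ring,
      cc_symm, cc_symm, cc_symm, cc_symm, this, cc_zero m N (N + 1) (by omega),
      cc_zero m N (N + 2) (by omega), cc_self hm]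
    simp
  obtain ⟨i, hi⟩ : ∃ i : ℕ, (i : ℤ) = N + k := ⟨(N + k).toNat, by omega⟩
  obtain ⟨j, hj⟩ : ∃ j : ℕ, (j : ℤ) = N - k := ⟨(N - k).toNat, by omega⟩
  have hij : i + j = 2 * N := by omega
  rw [show (N + 1 - k : ℤ).toNat = j + 1 by omega, show (N + 1 + k : ℤ).toNat = i + 1 by omega]
  unfold cc
  rw [show ((N + 1 : ℕ) : ℤ) + k = i + 1 by push_cast; omega,
    show ((N + 1 : ℕ) : ℤ) - k = j + 1 by push_cast; omega,
    show (N : ℤ) + (k - 1) = i - 1 by omega, show (N : ℤ) - (k - 1) = j + 1 by omega,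
    show (N : ℤ) + (k + 1) = i + 1 by omega, show (N : ℤ) - (k + 1) = j - 1 by omega,
    ← hi, ← hj, iq_pred hm i, iq_pred hm j, iq_succ hm i, iq_succ hm j,
    show 2 * (N + 1) = 2 * N + 1 + 1 by ring, qp_succ, qp_succ, pow_succ _ (2 * N), ← hij, pow_add]
  ring

def tt {A : Type*} [CommRing A] (a b q : A) : ℤ → A
  | Int.ofNat k => a ^ k * q ^ (k.choose 2)
  | Int.negSucc j => b ^ (j + 1) * q ^ ((j + 1).choose 2)

theorem tt_neg {A : Type*} [CommRing A] (a b q : A) (k : ℤ) : tt a b q (-k) = tt b a q k := by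
  rcases k with (_ | k) | k
  · simp [tt]
  · rfl
  · rfl

theorem tt_nat {A : Type*} [CommRing A] (a b q : A) (k : ℕ) :
    tt a b q k = a ^ k * q ^ (k.choose 2) := rfl

theorem tt_succ {A : Type*} [CommRing A] (a b q : A) (k : ℕ) :
    tt a b q (k + 1) = tt a b q k * a * q ^ k := by
  rw [show (k:ℤ) + 1 = ((k + 1 : ℕ) : ℤ) by push_cast; rfl, tt_nat, tt_nat, Nat.choose_succ_succ' k 1]
  simp; ring

theorem tt_A {A : Type*} [CommRing A] (a b q : A) (hab : a * b = q) (N : ℕ) (k : ℤ)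
    (_h1 : -(N : ℤ) ≤ k) (h2 : k ≤ N) :
    tt a b q k * a * q ^ N = tt a b q (k + 1) * q ^ (N - k).toNat := by
  rcases le_or_gt 0 k with h | h
  · lift k to ℕ using h
    rw [tt_succ, show (N - k : ℤ).toNat = N - k by omega]
    obtain ⟨d, rfl⟩ : ∃ d, N = k + d := ⟨N - k, by omega⟩
    rw [Nat.add_sub_cancel_left]; ring
  · obtain ⟨j, rfl⟩ : ∃ j : ℕ, k = -(j + 1 : ℤ) := ⟨(-k - 1).toNat, by omega⟩
    rw [tt_neg, tt_succ, show -(j + 1 : ℤ) + 1 = -j by ring, tt_neg,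
      show (N - -(j + 1 : ℤ)).toNat = N + j + 1 by omega, ← hab]
    ring

theorem tt_B {A : Type*} [CommRing A] (a b q : A) (hab : a * b = q) (N : ℕ) (k : ℤ)
    (h1 : -(N : ℤ) ≤ k) (h2 : k ≤ N) :
    tt a b q k * b * q ^ N = tt a b q (k - 1) * q ^ (N + k).toNat := by
  have := tt_A b a q (by rw [mul_comm, hab]) N (-k) (by omega) (by omega)
  rw [tt_neg, show -k + 1 = -(k - 1) by ring, tt_neg] at this
  rw [this]; simp

theorem tp_finite {A : Type*} [CommRing A] [Algebra R A] {m : ℕ} (hm : 0 < m) (a b : A)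
    (hab : a * b = algebraMap R A (X ^ m)) (N : ℕ) :
    ∏ n ∈ Finset.range N, ((1 + a * algebraMap R A (X ^ m) ^ n) *
      (1 + b * algebraMap R A (X ^ m) ^ n)) =
    ∑ k ∈ Finset.Icc (-(N:ℤ)) N, algebraMap R A (cc m N k) * tt a b (algebraMap R A (X ^ m)) k := by
  set q := algebraMap R A (X ^ m) with hq
  set t := tt a b q with ht
  induction N with
  | zero => 
    have := cc_self hm 0
    simp at this
    simp [this, ht, tt]
  | succ N ih =>
    rw [Finset.prod_range_succ, ih]
    have hs : ∀ f : ℤ → A, (∀ k, k < -(N:ℤ) ∨ N < k → f k = 0) →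
        ∑ k ∈ Finset.Icc (-(N:ℤ)) N, f k = ∑ k ∈ Finset.Icc (-((N + 1 : ℕ):ℤ)) (N + 1 : ℕ), f k := by
      intro f hf
      refine Finset.sum_subset ?_ ?_
      · intro x; simp only [Finset.mem_Icc]; push_cast; omega
      · intro x _ hx; apply hf; simp only [Finset.mem_Icc] at hx; omega
    have hs1 : ∀ f : ℤ → A, (∀ k, k - 1 < -(N:ℤ) ∨ N < k - 1 → f k = 0) →
        ∑ k ∈ Finset.Icc (-(N:ℤ)) N, f (k + 1) =
          ∑ k ∈ Finset.Icc (-((N + 1 : ℕ):ℤ)) (N + 1 : ℕ), f k := by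
      intro f hf
      have : ∑ k ∈ Finset.Icc (-(N:ℤ)) N, f (k + 1) =
          ∑ k ∈ (Finset.Icc (-(N:ℤ)) N).map (addRightEmbedding 1), f k := by
        rw [Finset.sum_map]; rfl
      rw [this]
      refine Finset.sum_subset ?_ ?_
      · intro x; simp only [Finset.map_add_right_Icc, Finset.mem_Icc]; push_cast; omega
      · intro x _ hx; apply hf; simp only [Finset.map_add_right_Icc, Finset.mem_Icc] at hx; omega
    have hs2 : ∀ f : ℤ → A, (∀ k, k + 1 < -(N:ℤ) ∨ N < k + 1 → f k = 0) →
        ∑ k ∈ Finset.Icc (-(N:ℤ)) N, f (k - 1) =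
          ∑ k ∈ Finset.Icc (-((N + 1 : ℕ):ℤ)) (N + 1 : ℕ), f k := by
      intro f hf
      have : ∑ k ∈ Finset.Icc (-(N:ℤ)) N, f (k - 1) =
          ∑ k ∈ (Finset.Icc (-(N:ℤ)) N).map (addRightEmbedding (-1)), f k := by
        rw [Finset.sum_map]; rfl
      rw [this]
      refine Finset.sum_subset ?_ ?_
      · intro x; simp only [Finset.map_add_right_Icc, Finset.mem_Icc]; push_cast; omega
      · intro x _ hx; apply hf; simp only [Finset.map_add_right_Icc, Finset.mem_Icc] at hx; omega
    have e1 : (∑ k ∈ Finset.Icc (-(N:ℤ)) N, algebraMap R A (cc m N k) * t k) *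
        ((1 + a * q ^ N) * (1 + b * q ^ N)) =
        ∑ k ∈ Finset.Icc (-(N:ℤ)) N, (1 + q ^ (2 * N + 1)) * (algebraMap R A (cc m N k) * t k) +
        ∑ k ∈ Finset.Icc (-(N:ℤ)) N, (fun k : ℤ => q ^ (N + 1 - k).toNat *
          algebraMap R A (cc m N (k - 1)) * t k) (k + 1) +
        ∑ k ∈ Finset.Icc (-(N:ℤ)) N, (fun k : ℤ => q ^ (N + 1 + k).toNat *
          algebraMap R A (cc m N (k + 1)) * t k) (k - 1) := by
      rw [Finset.sum_mul, ← Finset.sum_add_distrib, ← Finset.sum_add_distrib]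
      refine Finset.sum_congr rfl fun k hk => ?_
      rw [Finset.mem_Icc] at hk
      have hA := tt_A a b q hab N k hk.1 hk.2
      have hB := tt_B a b q hab N k hk.1 hk.2
      rw [← ht] at hA hB
      simp only
      rw [show (N + 1 - (k + 1) : ℤ) = N - k by ring, show (N + 1 + (k - 1) : ℤ) = N + k by ring,
        add_sub_cancel_right, sub_add_cancel]
      linear_combination algebraMap R A (cc m N k) * (hA + hB) +
        algebraMap R A (cc m N k) * t k * q ^ (2 * N) * hab
    rw [e1, hs, hs1 (fun k : ℤ => q ^ (N + 1 - k).toNat *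
          algebraMap R A (cc m N (k - 1)) * t k), hs2 (fun k : ℤ => q ^ (N + 1 + k).toNat *
          algebraMap R A (cc m N (k + 1)) * t k), ← Finset.sum_add_distrib, ← Finset.sum_add_distrib]
    · refine Finset.sum_congr rfl fun k hk => ?_
      rw [Finset.mem_Icc] at hk
      push_cast at hk
      rw [cc_rec hm N k (by omega) (by omega)]
      simp only [map_add, map_mul, map_pow, map_one, hq]
      ring
    · intro k hk; rw [cc_zero m N _ (by omega)]; simp
    · intro k hk; rw [cc_zero m N _ (by omega)]; simp
    · intro k hk; rw [cc_zero m N _ (by omega)]; simp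

theorem qp_dvd {m : ℕ} (hm : 0 < m) (n d : ℕ) : (X : R) ^ (n + 1) ∣ qp m (n + d) - qp m n := by
  induction d with
  | zero => simp
  | succ d ih =>
    rw [← add_assoc, qp_succ]
    have : (X : R) ^ (n + 1) ∣ X ^ m * (X ^ m) ^ (n + d) := by
      rw [← pow_mul, ← pow_add]
      refine pow_dvd_pow _ ?_
      nlinarith
    have h2 := dvd_sub ih (this.mul_left (qp m (n + d)))
    convert h2 using 1; ring

theorem qp_iq_dvd {m : ℕ} (hm : 0 < m) (n n' k : ℕ) (h : k ≤ n + 1) (h' : k ≤ n' + 1) :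
    (X : R) ^ k ∣ qp m n' * iq m n - 1 := by
  have h1 := qp_iq hm n
  have : qp m n' * iq m n - 1 = (qp m n' - qp m n) * iq m n := by rw [sub_mul, h1]
  rw [this]
  refine Dvd.dvd.mul_right ?_ _
  rcases le_total n n' with h3 | h3
  · obtain ⟨d, rfl⟩ := Nat.exists_eq_add_of_le h3
    exact (pow_dvd_pow _ h).trans (qp_dvd hm n d)
  · obtain ⟨d, rfl⟩ := Nat.exists_eq_add_of_le h3
    rw [dvd_sub_comm]
    exact (pow_dvd_pow _ h').trans (qp_dvd hm n' d)

theorem cc_dvd {m : ℕ} (hm : 0 < m) (N : ℕ) (k : ℤ) (hk : k.natAbs ≤ N) :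
    (X : R) ^ (N - k.natAbs + 1) ∣ qp m N * cc m N k - 1 := by
  wlog h0 : 0 ≤ k generalizing k
  · have := this (-k) (by simpa using hk) (by omega)
    rwa [cc_symm, Int.natAbs_neg] at this
  lift k to ℕ using h0
  simp only [Int.natAbs_natCast] at *
  have h1 := qp_iq_dvd hm (N + k) (2 * N) (N - k + 1) (by omega) (by omega)
  have h2 := qp_iq_dvd hm (N - k) N (N - k + 1) (by omega) (by omega)
  have h3 := dvd_add (h1.mul_left (qp m N * iq m (N - k : ℕ))) h2
  convert h3 using 1
  unfold cc
  push_cast [hk]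
  ring

theorem lim_Th {m : ℕ} (hm : 0 < m) {e : ℤ → ℤ} (hg : Good e) (w : ℤ → ℚ)
    (he : ∀ k, (k.natAbs : ℤ) ≤ e k + 1) (N : ℕ) :
    (X : R) ^ N ∣ qp m N * ∑ k ∈ Finset.Icc (-(N:ℤ)) N, cc m N k * (C (w k) * X ^ (e k).toNat)
      - Th e w := by
  have h1 : (X : R) ^ N ∣ qp m N * ∑ k ∈ Finset.Icc (-(N:ℤ)) N,
      cc m N k * (C (w k) * X ^ (e k).toNat)
      - ∑ k ∈ Finset.Icc (-(N:ℤ)) N, (C (w k) * X ^ (e k).toNat) := by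
    rw [Finset.mul_sum, ← Finset.sum_sub_distrib]
    refine Finset.dvd_sum fun k hk => ?_
    rw [Finset.mem_Icc] at hk
    have hd := cc_dvd hm N k (by omega)
    have := mul_dvd_mul hd (dvd_refl ((X : R) ^ (e k).toNat))
    rw [← pow_add] at this
    have h4 := (pow_dvd_pow (X : R) (show N ≤ N - k.natAbs + 1 + (e k).toNat by
      have := he k; have := hg.nn k; omega)).trans (this.mul_left (C (w k)))
    convert h4 using 1
    ring
  have h2 : (X : R) ^ N ∣ ∑ k ∈ Finset.Icc (-(N:ℤ)) N, (C (w k) * X ^ (e k).toNat) - Th e w := by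
    rw [X_pow_dvd_iff]
    intro n hn
    rw [map_sub, coeff_Th_fin hg, map_sum, sub_eq_zero]
    simp only [coeff_C_mul_X_pow]
    rw [← Finset.sum_filter]
    refine Finset.sum_congr ?_ (fun _ _ => rfl)
    ext k
    have := he k
    have := hg.nn k
    simp only [Finset.mem_filter, Finset.mem_Icc, Set.Finite.mem_toFinset, Set.mem_ofPred_eq]
    omega
  have := dvd_add h1 h2
  simpa using this

end T7

namespace T7
open PowerSeries

noncomputable def prf (ε : ℚ) (m r N : ℕ) : R := ∏ n ∈ Finset.range N, (1 + C ε * X ^ (m * n + r))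

noncomputable def pr (ε : ℚ) (m r : ℕ) : R := PowerSeries.mk fun n => coeff n (prf ε m r n)

def Lim (s : ℕ → R) (A : R) : Prop := ∀ N K, N ≤ K → (X : R) ^ N ∣ s K - A

theorem Lim.mul {s t : ℕ → R} {A B : R} (h : Lim s A) (h' : Lim t B) :
    Lim (fun K => s K * t K) (A * B) := by
  intro N K hK
  have := dvd_add ((h N K hK).mul_right (t K)) ((h' N K hK).mul_left A)
  convert this using 1; ring

theorem Lim.neg {s : ℕ → R} {A : R} (h : Lim s A) : Lim (fun K => - s K) (-A) := by
  intro N K hK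
  have := (h N K hK).neg_right
  convert this using 1; ring

theorem Lim.comp {s : ℕ → R} {A : R} (h : Lim s A) {f : ℕ → ℕ} (hf : ∀ K, K ≤ f K) :
    Lim (fun K => s (f K)) A := fun N K hK => h N (f K) (hK.trans (hf K))

theorem Lim.uniq {s : ℕ → R} {A B : R} (h : Lim s A) (h' : Lim s B) : A = B := by
  ext n
  have h1 := h (n + 1) (n + 1) le_rfl
  have h2 := h' (n + 1) (n + 1) le_rfl
  have h3 := dvd_sub h2 h1
  rw [X_pow_dvd_iff] at h3
  have := h3 n (by omega)
  rw [show s (n + 1) - B - (s (n + 1) - A) = A - B by ring, map_sub] at this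
  linarith

theorem prf_dvd (ε : ℚ) {m r : ℕ} (hm : 0 < m) (hr : 0 < r) (n d : ℕ) :
    (X : R) ^ (n + 1) ∣ prf ε m r (n + d) - prf ε m r n := by
  induction d with
  | zero => simp
  | succ d ih =>
    unfold prf at *
    rw [← add_assoc, Finset.prod_range_succ]
    have : (X : R) ^ (n + 1) ∣ X ^ (m * (n + d) + r) := by
      refine pow_dvd_pow _ ?_
      nlinarith
    have h2 := dvd_add ih (this.mul_left (prf ε m r (n + d) * C ε))
    convert h2 using 1; unfold prf; ring

theorem lim_pr (ε : ℚ) {m r : ℕ} (hm : 0 < m) (hr : 0 < r) : Lim (prf ε m r) (pr ε m r) := by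
  intro N K hK
  rw [X_pow_dvd_iff]
  intro n hn
  obtain ⟨d, rfl⟩ := Nat.exists_eq_add_of_le (show n ≤ K by omega)
  have := prf_dvd ε hm hr n d
  rw [X_pow_dvd_iff] at this
  have := this n (by omega)
  rw [map_sub] at this ⊢
  rw [pr, coeff_mk]; exact this

theorem prf_split (ε : ℚ) (m r d K : ℕ) :
    prf ε m r (d * K) = ∏ j ∈ Finset.range d, prf ε (d * m) (r + j * m) K := by
  induction K with
  | zero => simp [prf]
  | succ K ih =>
    have : ∀ j, prf ε (d * m) (r + j * m) (K + 1) = prf ε (d * m) (r + j * m) K *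
        (1 + C ε * X ^ (m * (d * K + j) + r)) := by
      intro j
      unfold prf
      rw [Finset.prod_range_succ]; congr 4; ring
    simp only [this, Finset.prod_mul_distrib]
    rw [← ih, mul_add, mul_one]
    unfold prf
    rw [Finset.prod_range_add]

theorem Lim.prod {n : ℕ} {s : ℕ → ℕ → R} {A : ℕ → R} (h : ∀ j, Lim (s j) (A j)) :
    Lim (fun K => ∏ j ∈ Finset.range n, s j K) (∏ j ∈ Finset.range n, A j) := by
  induction n with
  | zero => intro N K _; simp
  | succ n ih => simp only [Finset.prod_range_succ]; exact ih.mul (h n)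

theorem pr_split (ε : ℚ) {m r d : ℕ} (hm : 0 < m) (hr : 0 < r) (hd : 0 < d) :
    pr ε m r = ∏ j ∈ Finset.range d, pr ε (d * m) (r + j * m) := by
  have h1 : Lim (fun K => prf ε m r (d * K)) (pr ε m r) :=
    (lim_pr ε hm hr).comp (fun K => by nlinarith)
  have h2 : Lim (fun K => ∏ j ∈ Finset.range d, prf ε (d * m) (r + j * m) K) _ :=
    Lim.prod fun j => lim_pr ε (m := d * m) (r := r + j * m) (by positivity) (by positivity)
  simp only [prf_split] at h1
  exact h1.uniq h2

noncomputable def E (m : ℕ) : R := pr (-1) m m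
noncomputable def P (m : ℕ) : R := pr 1 (2 * m) m
noncomputable def Mi (m : ℕ) : R := pr (-1) (2 * m) m

theorem E_split {m : ℕ} (hm : 0 < m) : E m = E (2 * m) * Mi m := by
  unfold E Mi
  rw [pr_split (-1) hm hm (d := 2) (by norm_num)]
  simp only [Finset.prod_range_succ, Finset.range_zero, Finset.prod_empty]
  rw [show m + 0 * m = m by ring, show m + 1 * m = 2 * m by ring]; ring

theorem P_Mi {m : ℕ} (hm : 0 < m) : P m * Mi m = Mi (2 * m) := by
  unfold P Mi
  have h1 := (lim_pr 1 (m := 2 * m) (by positivity) hm).mul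
    (lim_pr (-1) (m := 2 * m) (by positivity) hm)
  have h2 := lim_pr (-1) (m := 2 * (2 * m)) (r := 2 * m) (by positivity) (by positivity)
  refine h1.uniq ?_
  convert h2 using 2 with K
  unfold prf
  rw [← Finset.prod_mul_distrib]
  refine Finset.prod_congr rfl fun n _ => ?_
  simp only [map_neg, map_one]
  ring

theorem lim_E {m : ℕ} (hm : 0 < m) : Lim (qp m) (E m) := lim_pr (-1) hm hm

theorem TP (ε : ℚ) (hε : ε * ε = 1) {r s M : ℕ} (hr : 0 < r) (hs : 0 < s) (hM : r + s = M)
    {e : ℤ → ℤ} (he : ∀ k, 2 * e k = M * (k * (k - 1)) + 2 * r * k) :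
    Th e (fun k => ε ^ k.natAbs) = E M * (pr ε M r * pr ε M s) := by
  have hM0 : 0 < M := by omega
  have hsq : ∀ k, k ^ 2 ≤ e k := by
    intro k
    have h1 := he k
    subst hM
    push_cast at h1
    rcases le_or_gt 0 k with h | h
    · have : (0:ℤ) ≤ ((r:ℤ) - 1) * (k * k) := mul_nonneg (by omega) (by positivity)
      rcases h.eq_or_lt with h0 | h0
      · subst h0; nlinarith
      have : (0:ℤ) ≤ ((s:ℤ) - 1) * (k * (k - 1)) := mul_nonneg (by omega) (by nlinarith)
      have : (0:ℤ) ≤ ((r:ℤ) - 1) * k := mul_nonneg (by omega) (by omega)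
      nlinarith
    · have : (0:ℤ) ≤ ((r:ℤ) - 1) * (k * (k + 1)) := mul_nonneg (by omega) (by nlinarith)
      have : (0:ℤ) ≤ ((s:ℤ) - 1) * (k * (k - 1)) := mul_nonneg (by omega) (by nlinarith)
      nlinarith
  have hg : Good e := good_Z (fun x => le_trans (by positivity) (hsq x))
    (fun x => by have := hsq x; nlinarith [sq_nonneg x])
  have hab : (C ε * X ^ r : R) * (C ε * X ^ s) = algebraMap R R (X ^ M) := by
    rw [Algebra.algebraMap_self_apply, ← hM, pow_add, mul_mul_mul_comm, ← map_mul, hε]; simp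
  have htt : ∀ k, tt (C ε * X ^ r : R) (C ε * X ^ s) (X ^ M) k =
      C (ε ^ k.natAbs) * X ^ (e k).toNat := by
    have key : ∀ (r' s' : ℕ) (j : ℕ) (t : ℕ), 2 * (t:ℤ) = M * (j * (j - 1)) + 2 * r' * j →
        (C ε * X ^ r' : R) ^ j * (X ^ M) ^ (j.choose 2) = C (ε ^ j) * X ^ t := by
      intro r' s' j t h
      have hc : (2 * (j.choose 2 : ℤ)) = j * (j - 1) := by
        rw [Nat.choose_two_right]
        have := Nat.even_mul_pred_self j
        have h2 : 2 * (j * (j - 1) / 2) = j * (j - 1) := Nat.mul_div_cancel' this.two_dvd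
        cases j with
        | zero => simp
        | succ j =>
          zify at h2
          simpa using h2
      have : t = r' * j + M * j.choose 2 := by
        have : (2 * (t:ℤ)) = 2 * (r' * j + M * j.choose 2) := by
          rw [h]; linear_combination (-(M:ℤ)) * hc
        zify; linarith
      rw [this, map_pow]; ring
    intro k
    have h1 := he k
    have h0 := hg.nn k
    rcases k with k | j
    · refine key r s k _ ?_
      rw [Int.toNat_of_nonneg h0]; simpa using h1
    · refine key s r (j + 1) _ ?_
      rw [Int.toNat_of_nonneg h0, h1, Int.negSucc_eq]; push_cast [← hM]; ring
  refine Lim.uniq (s := fun N => qp M N * (prf ε M r N * prf ε M s N)) ?_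
    ((lim_E hM0).mul ((lim_pr ε hM0 hr).mul (lim_pr ε hM0 hs)))
  intro N K hK
  refine (pow_dvd_pow _ hK).trans ?_
  have h1 := lim_Th hM0 hg (fun k => ε ^ k.natAbs) (fun k => by
    have := hsq k
    have : (k.natAbs : ℤ) ≤ (k.natAbs : ℤ) ^ 2 + 1 := by nlinarith
    rw [Int.natAbs_sq] at this; linarith) K
  convert h1 using 3
  have h2 := tp_finite hM0 _ _ hab K
  simp only [Algebra.algebraMap_self_apply, htt] at h2
  rw [← h2, Finset.prod_mul_distrib]
  unfold prf
  congr 1 <;> refine Finset.prod_congr rfl fun n _ => ?_ <;> ring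

theorem sg_eq (k : ℤ) : (-1 : ℚ) ^ k.natAbs = sg k := by
  unfold sg
  split_ifs with h
  · exact Even.neg_one_pow (Int.natAbs_even.2 (Int.even_iff.2 h))
  · exact Odd.neg_one_pow (Int.natAbs_odd.2 (Int.odd_iff.2 (by omega)))

theorem ph_prod {m : ℕ} (hm : 0 < m) : ph m = E (2 * m) * (P m * P m) := by
  unfold P
  rw [← TP 1 (by norm_num) hm hm (by ring) (e := fun x => (m:ℤ) * x ^ 2) (fun k => by push_cast; ring)]
  exact Th_congr (fun _ => rfl) (fun _ => by simp)

theorem pm_prod {m : ℕ} (hm : 0 < m) : pm m = E (2 * m) * (Mi m * Mi m) := by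
  unfold Mi
  rw [← TP (-1) (by norm_num) hm hm (by ring) (e := fun x => (m:ℤ) * x ^ 2) (fun k => by push_cast; ring)]
  exact Th_congr (fun _ => rfl) (fun _ => by rw [sg_eq])

theorem ps_prod {m : ℕ} (hm : 0 < m) : ps m = E (4 * m) * P m := by
  have h1 : P m = pr 1 (4 * m) (3 * m) * pr 1 (4 * m) m := by
    unfold P
    rw [pr_split 1 (by positivity) hm (d := 2) (by norm_num)]
    simp only [Finset.prod_range_succ, Finset.range_zero, Finset.prod_empty]
    rw [show m + 0 * (2 * m) = m by ring, show m + 1 * (2 * m) = 3 * m by ring,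
      show 2 * (2 * m) = 4 * m by ring]; ring
  rw [h1, ← TP 1 (by norm_num) (by positivity) hm (by ring)
    (e := fun x => (m:ℤ) * (2 * x ^ 2 + x)) (fun k => by push_cast; ring)]
  exact Th_congr (fun _ => rfl) (fun _ => by simp)

end T7

namespace T7
open PowerSeries

theorem F1 {m : ℕ} (hm : 0 < m) : pm (2 * m) ^ 2 = ph m * pm m := by
  rw [pm_prod hm, ph_prod hm, pm_prod (show 0 < 2 * m by omega), E_split (show 0 < 2 * m by omega),
    ← P_Mi hm]; ring

theorem F2 {m : ℕ} (hm : 0 < m) : ps m ^ 2 = ph m * ps (2 * m) := by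
  have h1 := E_split (show 0 < 2 * m by omega)
  have h2 := E_split (show 0 < 4 * m by omega)
  have h3 := P_Mi (show 0 < 2 * m by omega)
  rw [show 2 * (2 * m) = 4 * m by ring] at h1 h3
  rw [show 2 * (4 * m) = 8 * m by ring] at h2
  rw [ps_prod hm, ph_prod hm, ps_prod (show 0 < 2 * m by omega), h1,
    show 4 * (2 * m) = 8 * m by ring]
  linear_combination (E (4 * m) * P m ^ 2) * h2 - (E (4 * m) * P m ^ 2 * E (8 * m)) * h3

theorem tri_two (k : ℤ) : 2 * (k * (k - 1) / 2) = k * (k - 1) :=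
  Int.mul_ediv_cancel' (by
    have := Int.even_mul_succ_self (k - 1)
    rw [sub_add_cancel, mul_comm] at this
    exact this.two_dvd)

open TrivSqZeroExt DualNumber in
theorem dual_tt {m : ℕ} (k : ℤ) :
    snd (tt (-(1 + ε) : DualNumber R) (-(algebraMap R (DualNumber R) (X ^ m) * (1 - ε)))
      (algebraMap R (DualNumber R) (X ^ m)) k) =
      C (sg k * k) * X ^ (m * (k * (k - 1) / 2)).toNat := by
  have hε : (ε : DualNumber R) * ε = 0 := eps_mul_eps
  have hp : ∀ (j : ℕ), (-(1 + ε) : DualNumber R) ^ j =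
      algebraMap R (DualNumber R) (C ((-1) ^ j)) * (1 + algebraMap R (DualNumber R) (C (j:ℚ)) * ε) := by
    intro j
    induction j with
    | zero => simp
    | succ j ih =>
      rw [pow_succ, ih]
      simp only [pow_succ, map_mul, map_neg, map_one, Nat.cast_add, map_add, Nat.cast_one]
      linear_combination (-(algebraMap R (DualNumber R) (C ((-1) ^ j)) *
        algebraMap R (DualNumber R) (C (j:ℚ)))) * hε
  have hn : ∀ (j : ℕ), (-(1 - ε) : DualNumber R) ^ j =
      algebraMap R (DualNumber R) (C ((-1) ^ j)) * (1 - algebraMap R (DualNumber R) (C (j:ℚ)) * ε) := by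
    intro j
    induction j with
    | zero => simp
    | succ j ih =>
      rw [pow_succ, ih]
      simp only [pow_succ, map_mul, map_neg, map_one, Nat.cast_add, map_add, Nat.cast_one]
      linear_combination (-(algebraMap R (DualNumber R) (C ((-1) ^ j)) *
        algebraMap R (DualNumber R) (C (j:ℚ)))) * hε
  have hsnd : ∀ (x y : R), snd (algebraMap R (DualNumber R) x * (1 + algebraMap R (DualNumber R) y * ε))
      = x * y := by
    intro x y
    rw [← Algebra.smul_def, ← Algebra.smul_def]
    simp
  have hsnd' : ∀ (x y : R), snd (algebraMap R (DualNumber R) x * (1 - algebraMap R (DualNumber R) y * ε))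
      = - (x * y) := by
    intro x y
    rw [← Algebra.smul_def, ← Algebra.smul_def]
    simp
  have hc : ∀ j : ℕ, (2 * (j.choose 2 : ℤ)) = j * (j - 1) := by
    intro j
    rw [Nat.choose_two_right]
    have := Nat.even_mul_pred_self j
    have h2 : 2 * (j * (j - 1) / 2) = j * (j - 1) := Nat.mul_div_cancel' this.two_dvd
    cases j with
    | zero => simp
    | succ j =>
      zify at h2
      simpa using h2
  have h2 := tri_two k
  rcases k with k | j
  · have h3 := hc k
    have : (m * ((k:ℤ) * (k - 1) / 2)).toNat = m * k.choose 2 := by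
      have : ((k:ℤ) * (k - 1) / 2) = k.choose 2 := by simp at h2; omega
      rw [this]; norm_cast
    simp only [Int.ofNat_eq_natCast]
    rw [this, tt_nat, hp, ← sg_eq, ← map_pow,
      show ∀ a b c : DualNumber R, a * b * c = (c * a) * b from fun _ _ _ => by ring, ← map_mul, hsnd,
      Int.natAbs_natCast]
    push_cast
    rw [map_mul]; ring
  · have h3 := hc (j + 1)
    rw [Int.negSucc_eq] at h2 ⊢
    have : (m * ((-((j:ℤ) + 1)) * ((-((j:ℤ) + 1)) - 1) / 2)).toNat = m * ((j + 1).choose 2 + (j + 1)) := by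
      have : (((-((j:ℤ) + 1)) * ((-((j:ℤ) + 1)) - 1) / 2)) = ((j + 1).choose 2 + (j + 1) : ℕ) := by
        push_cast at h3 ⊢
        have : 2 * (((-((j:ℤ) + 1)) * ((-((j:ℤ) + 1)) - 1) / 2)) = 2 * ((j + 1).choose 2 + (j + 1)) := by
          rw [h2]; linear_combination -h3
        linarith
      rw [this]; norm_cast
    rw [this, show -((j:ℤ) + 1) = -((j + 1 : ℕ) : ℤ) by push_cast; ring, tt_neg, tt_nat, ← mul_neg, mul_pow, hn,
      show ∀ a b c d : DualNumber R, a * (b * c) * d = (a * b * d) * c from fun _ _ _ _ => by ring,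
      ← map_pow, ← map_pow, ← map_mul, ← map_mul, hsnd', ← sg_eq, Int.natAbs_neg, Int.natAbs_natCast]
    simp only [map_mul, Int.cast_neg, map_neg, Int.cast_natCast]
    ring

open TrivSqZeroExt DualNumber in
theorem J_fin {m : ℕ} (hm : 0 < m) (N : ℕ) : - (qp m N * qp m (N + 1)) =
    ∑ k ∈ Finset.Icc (-((N + 1 : ℕ):ℤ)) (N + 1 : ℕ), cc m (N + 1) k *
      (C (sg k * k) * X ^ (m * (k * (k - 1) / 2)).toNat) := by
  have hε : (ε : DualNumber R) * ε = 0 := eps_mul_eps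
  have h := tp_finite hm (-(1 + ε) : DualNumber R) (-(algebraMap R (DualNumber R) (X ^ m) * (1 - ε)))
    (by linear_combination (- algebraMap R (DualNumber R) (X ^ m)) * hε) (N + 1)
  have h2 := congrArg snd h
  rw [TrivSqZeroExt.snd_sum] at h2
  have h3 : ∀ k, snd (algebraMap R (DualNumber R) (cc m (N + 1) k) * tt (-(1 + ε) : DualNumber R)
      (-(algebraMap R (DualNumber R) (X ^ m) * (1 - ε)))
      (algebraMap R (DualNumber R) (X ^ m)) k) =
      cc m (N + 1) k * (C (sg k * k) * X ^ (m * (k * (k - 1) / 2)).toNat) := by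
    intro k
    rw [← Algebra.smul_def, TrivSqZeroExt.snd_smul, dual_tt, smul_eq_mul]
  simp only [h3] at h2
  rw [← h2, Finset.prod_mul_distrib, Finset.prod_range_succ']
  have h4 : ∀ z w : DualNumber R, snd (z * (1 + -(1 + ε) * algebraMap R (DualNumber R) (X ^ m) ^ 0) * w) =
      - (fst z * fst w) := by
    intro z w
    rw [show z * (1 + -(1 + ε) * algebraMap R (DualNumber R) (X ^ m) ^ 0) * w = - (z * w * ε) by ring,
      TrivSqZeroExt.snd_neg, TrivSqZeroExt.snd_mul]
    simp
  rw [h4]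
  have hf : ∀ z : DualNumber R, fst z = fstHom R R R z := fun _ => rfl
  have ha : ∀ x : R, fst (algebraMap R (DualNumber R) x) = x := fun _ => rfl
  rw [hf, hf, map_prod, map_prod]
  simp only [← hf]
  congr 2
  · unfold qp
    refine Finset.prod_congr rfl fun n _ => ?_
    rw [← map_pow]
    simp only [TrivSqZeroExt.fst_add, TrivSqZeroExt.fst_mul, TrivSqZeroExt.fst_neg, TrivSqZeroExt.fst_one,
      TrivSqZeroExt.fst_sub, map_neg, map_one, ha, fst_eps]
    ring
  · unfold qp
    refine Finset.prod_congr rfl fun n _ => ?_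
    rw [← map_pow]
    simp only [TrivSqZeroExt.fst_add, TrivSqZeroExt.fst_mul, TrivSqZeroExt.fst_neg, TrivSqZeroExt.fst_one,
      TrivSqZeroExt.fst_sub, map_neg, map_one, ha, fst_eps]
    ring

theorem J_E {m : ℕ} (hm : 0 < m) : J m = E m ^ 3 := by
  set e : ℤ → ℤ := fun k => m * (k * (k - 1) / 2) with he
  have hnn : ∀ k : ℤ, 0 ≤ k * (k - 1) := by
    intro k; rcases le_or_gt k 0 with h | h <;> nlinarith
  have hge : ∀ k, k * (k - 1) ≤ 2 * e k := by
    intro k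
    have h1 := tri_two k
    have : (0:ℤ) ≤ ((m:ℤ) - 1) * (k * (k - 1) / 2) := mul_nonneg (by omega) (by have := hnn k; omega)
    simp only [he]; nlinarith
  have hg : Good e := good_Z (fun k => by have := hge k; have := hnn k; linarith) (fun k => by
    have := hge k; nlinarith [sq_nonneg (k - 1)])
  have hL : Lim (fun N => - (qp m N * qp m (N + 1) * qp m (N + 1))) (Th e (fun k => sg k * k)) := by
    intro N K hK
    have h := lim_Th hm hg (fun k => sg k * k) (fun k => by
      have := hge k
      rcases le_or_gt k 0 with h | h
      · rw [show (k.natAbs : ℤ) = -k by omega]; nlinarith [sq_nonneg (2 * k + 1)]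
      · rw [show (k.natAbs : ℤ) = k by omega]; nlinarith [sq_nonneg (2 * k - 3)]) (K + 1)
    rw [← J_fin hm K] at h
    refine (pow_dvd_pow _ (show N ≤ K + 1 by omega)).trans ?_
    convert h using 1; ring
  have h1 := hL.uniq (((lim_E hm).mul ((lim_E hm).comp (f := fun K => K + 1) (fun K => by omega))).mul
    ((lim_E hm).comp (f := fun K => K + 1) (fun K => by omega))).neg
  have h2 : Th e (fun k => sg k * k) = - J m := by
    rw [Th_split hg _ (fun n : ℤ => 2 * -n) (fun n : ℤ => 2 * n + 1)]
    · have hs : J m = - (C (-1 : ℚ) * J m) := by simp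
      have : ∀ n : ℤ, e (2 * -n) = (m:ℤ) * (2 * n ^ 2 + n) := by
        intro n
        simp only [he]
        rw [show 2 * -n * (2 * -n - 1) = 2 * (2 * n ^ 2 + n) by ring, Int.mul_ediv_cancel_left _ (by norm_num)]
      have h' : ∀ n : ℤ, e (2 * n + 1) = (m:ℤ) * (2 * n ^ 2 + n) := by
        intro n
        simp only [he]
        rw [show (2 * n + 1) * (2 * n + 1 - 1) = 2 * (2 * n ^ 2 + n) by ring, Int.mul_ediv_cancel_left _ (by norm_num)]
      simp only [this, h']
      rw [Th_add (good_ps hm), hs, neg_neg]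
      unfold J
      rw [Th_smul (good_ps hm)]
      refine Th_congr (fun _ => rfl) (fun n => ?_)
      have h1 : sg (2 * -n) = 1 := by unfold sg; rw [if_pos (by omega)]
      have h2 : sg (2 * n + 1) = -1 := by unfold sg; rw [if_neg (by omega)]
      rw [h1, h2]; push_cast; ring
    · constructor
      · rintro (a | a) (b | b) h <;> simp at h ⊢ <;> omega
      · intro k
        rcases Int.emod_two_eq_zero_or_one k with h | h
        · exact ⟨.inl (-(k / 2)), by simp; omega⟩
        · exact ⟨.inr (k / 2), by simp; omega⟩
  rw [h2] at h1
  linear_combination -h1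

theorem F5 {m : ℕ} (hm : 0 < m) : J m = ps m * pm m ^ 2 := by
  have h1 := E_split (show 0 < 2 * m by omega)
  rw [show 2 * (2 * m) = 4 * m by ring, ← P_Mi hm] at h1
  rw [J_E hm, ps_prod hm, pm_prod hm, E_split hm]
  linear_combination (E (2 * m) ^ 2 * Mi m ^ 3) * h1

noncomputable def fr (r : ℕ) : R := Th (fun k : ℤ => 7 * k ^ 2 - 7 * k + r * k) (fun _ => 1)

theorem fr_prod {r s : ℕ} (hr : 0 < r) (hs : 0 < s) (h : r + s = 14) :
    fr r = E 14 * (pr 1 14 r * pr 1 14 s) := by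
  rw [← TP 1 (by norm_num) hr hs h (e := fun k => 7 * k ^ 2 - 7 * k + r * k) (fun k => by push_cast; ring)]
  exact Th_congr (fun _ => rfl) (fun _ => by simp)

theorem T5 : (fr 1 * fr 3 * fr 5) ^ 6 * ph 7 ^ 3 * J 2 = J 14 ^ 7 * ph 1 ^ 3 := by
  have h1 : P 1 = pr 1 14 1 * pr 1 14 3 * pr 1 14 5 * P 7 * pr 1 14 9 * pr 1 14 11 * pr 1 14 13 := by
    unfold P
    rw [pr_split 1 (by norm_num) (by norm_num) (d := 7) (by norm_num)]
    simp only [Finset.prod_range_succ, Finset.range_zero, Finset.prod_empty]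
    norm_num
  have h2 : fr 1 * fr 3 * fr 5 * P 7 = E 14 ^ 3 * P 1 := by
    rw [fr_prod (s := 13) (by norm_num) (by norm_num) (by norm_num),
      fr_prod (s := 11) (by norm_num) (by norm_num) (by norm_num),
      fr_prod (s := 9) (by norm_num) (by norm_num) (by norm_num), h1]
    ring
  rw [J_E (by norm_num), J_E (by norm_num), ph_prod (show 0 < 7 by norm_num), ph_prod (show 0 < 1 by norm_num)]
  norm_num
  calc _ = (fr 1 * fr 3 * fr 5 * P 7) ^ 6 * E 14 ^ 3 * E 2 ^ 3 := by ring
    _ = _ := by rw [h2]; ring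

end T7

namespace T7
open PowerSeries

theorem bij_par : (Sum.elim (fun p : ℤ × ℤ => (p.1 + p.2, p.1 - p.2))
    (fun p : ℤ × ℤ => (p.1 + p.2 + 1, p.1 - p.2))).Bijective := by
  constructor
  · rintro (⟨a, b⟩ | ⟨a, b⟩) (⟨c, d⟩ | ⟨c, d⟩) h <;> simp [Prod.ext_iff] at h ⊢ <;> omega
  · rintro ⟨x, y⟩
    rcases Int.emod_two_eq_zero_or_one (x + y) with h | h
    · exact ⟨.inl ((x + y) / 2, (x - y) / 2), by simp [Prod.ext_iff]; omega⟩
    · exact ⟨.inr ((x + y - 1) / 2, (x - y - 1) / 2), by simp [Prod.ext_iff]; omega⟩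

theorem bij_even_left : (Sum.elim (fun p : ℤ × ℤ => (2 * p.1, p.2))
    (fun p : ℤ × ℤ => (2 * p.1 + 1, p.2))).Bijective := by
  constructor
  · rintro (⟨a, b⟩ | ⟨a, b⟩) (⟨c, d⟩ | ⟨c, d⟩) h <;> simp [Prod.ext_iff] at h ⊢ <;> omega
  · rintro ⟨x, y⟩
    rcases Int.emod_two_eq_zero_or_one x with h | h
    · exact ⟨.inl (x / 2, y), by simp [Prod.ext_iff]; omega⟩
    · exact ⟨.inr (x / 2, y), by simp [Prod.ext_iff]; omega⟩

theorem bij_even_right : (Sum.elim (fun p : ℤ × ℤ => (p.1, 2 * p.2))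
    (fun p : ℤ × ℤ => (p.1, 2 * p.2 + 1))).Bijective := by
  constructor
  · rintro (⟨a, b⟩ | ⟨a, b⟩) (⟨c, d⟩ | ⟨c, d⟩) h <;> simp [Prod.ext_iff] at h ⊢ <;> omega
  · rintro ⟨x, y⟩
    rcases Int.emod_two_eq_zero_or_one y with h | h
    · exact ⟨.inl (x, y / 2), by simp [Prod.ext_iff]; omega⟩
    · exact ⟨.inr (x, y / 2), by simp [Prod.ext_iff]; omega⟩

theorem bij_par2 : (Sum.elim (fun p : ℤ × ℤ => (2 * p.1 + p.2, p.2))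
    (fun p : ℤ × ℤ => (2 * p.1 + 1 + p.2, p.2))).Bijective := by
  constructor
  · rintro (⟨a, b⟩ | ⟨a, b⟩) (⟨c, d⟩ | ⟨c, d⟩) h <;> simp [Prod.ext_iff] at h ⊢ <;> omega
  · rintro ⟨x, y⟩
    rcases Int.emod_two_eq_zero_or_one (x - y) with h | h
    · exact ⟨.inl ((x - y) / 2, y), by simp [Prod.ext_iff]; omega⟩
    · exact ⟨.inr ((x - y) / 2, y), by simp [Prod.ext_iff]; omega⟩

theorem sg_even {x : ℤ} (h : x % 2 = 0) : sg x = 1 := by unfold sg; rw [if_pos h]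
theorem sg_odd {x : ℤ} (h : x % 2 = 1) : sg x = -1 := by unfold sg; rw [if_neg (by omega)]

theorem good_tri {m : ℕ} (hm : 0 < m) : Good (fun x : ℤ => (m:ℤ) * (x ^ 2 + x)) :=
  (good_Z (Q := fun x => x ^ 2 + x)
    (fun x => by rcases le_or_gt 0 x with h | h <;> nlinarith)
    (fun x => by nlinarith [sq_nonneg (x + 1)])).smul (by omega)

theorem tri_ps {m : ℕ} (hm : 0 < m) : Th (fun x : ℤ => ((2 * m : ℕ):ℤ) * (x ^ 2 + x)) (fun _ => 1) =
    2 * ps (4 * m) := by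
  rw [Th_split (good_tri (show 0 < 2 * m by omega)) _ (fun n : ℤ => 2 * n) (fun n : ℤ => -2 * n - 1)]
  · unfold ps
    rw [two_mul (Th _ _)]
    congr 1 <;> refine Th_congr (fun n => ?_) (fun _ => rfl) <;> push_cast <;> ring
  · constructor
    · rintro (a | a) (b | b) h <;> simp at h ⊢ <;> omega
    · intro k
      rcases Int.emod_two_eq_zero_or_one k with h | h
      · exact ⟨.inl (k / 2), by simp; omega⟩
      · exact ⟨.inr ((-k - 1) / 2), by simp; omega⟩

theorem ph_pm {m : ℕ} (hm : 0 < m) : ph m ^ 2 + pm m ^ 2 = 2 * ph (2 * m) ^ 2 ∧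
    ph m ^ 2 - pm m ^ 2 = 8 * X ^ m * ps (4 * m) ^ 2 := by
  have hg := (good_ph hm).prod (good_ph hm)
  have e1 : Th (fun i : ℤ × ℤ => (m:ℤ) * (i.1 + i.2) ^ 2 + m * (i.1 - i.2) ^ 2) (fun _ => 1) =
      ph (2 * m) ^ 2 := by
    rw [pow_two, ph, Th_mul (good_ph (by omega)) (good_ph (by omega))]
    refine Th_congr (fun x => ?_) (fun _ => by ring)
    push_cast; ring
  have e2 : Th (fun i : ℤ × ℤ => (m:ℤ) * (i.1 + i.2 + 1) ^ 2 + m * (i.1 - i.2) ^ 2) (fun _ => 1) =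
      X ^ m * (2 * ps (4 * m)) ^ 2 := by
    have hg2 := good_tri (show 0 < 2 * m by omega)
    rw [← tri_ps hm, pow_two, Th_mul hg2 hg2, Th_X (hg2.prod hg2)]
    refine Th_congr (fun x => ?_) (fun _ => by ring)
    push_cast; ring
  have h1 : ph m ^ 2 = ph (2 * m) ^ 2 + X ^ m * (2 * ps (4 * m)) ^ 2 := by
    rw [← e1, ← e2, pow_two, ph, Th_mul (good_ph hm) (good_ph hm), Th_split hg _ _ _ bij_par]
    simp
  have h2 : pm m ^ 2 = ph (2 * m) ^ 2 + C (-1) * (X ^ m * (2 * ps (4 * m)) ^ 2) := by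
    have hg2 : Good (fun i : ℤ × ℤ => (m:ℤ) * (i.1 + i.2 + 1) ^ 2 + m * (i.1 - i.2) ^ 2) :=
      hg.comp (bij_par.1.comp Sum.inr_injective)
    rw [← e1, ← e2, Th_smul hg2, pow_two, pm,
      Th_mul (good_ph hm) (good_ph hm), Th_split hg _ _ _ bij_par]
    congr 1
    · refine Th_congr (fun _ => rfl) (fun x => ?_)
      rw [sg_add, sg_even]; omega
    · refine Th_congr (fun _ => rfl) (fun x => ?_)
      rw [sg_add, sg_odd]; ring; omega
  simp only [map_neg, map_one] at h2
  rw [h1, h2]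
  constructor <;> ring

theorem F3 {m : ℕ} (hm : 0 < m) : ph m ^ 4 = pm m ^ 4 + 16 * X ^ m * ps (2 * m) ^ 4 := by
  obtain ⟨h1, h2⟩ := ph_pm hm
  have h3 := F2 (show 0 < 2 * m by omega)
  rw [show 2 * (2 * m) = 4 * m by ring] at h3
  rw [show ps (2 * m) ^ 4 = (ps (2 * m) ^ 2) ^ 2 by ring, h3]
  linear_combination (ph m ^ 2 - pm m ^ 2) * h1 + 2 * ph (2 * m) ^ 2 * h2

def f4 (p : ℤ × ℤ) : ℤ × ℤ :=
  if p.1 % 2 = 0 then (p.2 + p.1 / 2, p.2 - p.1 / 2)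
  else (-p.2 - p.1 / 2 - 1, -p.2 + p.1 / 2)

theorem f4_bij : f4.Bijective := by
  constructor
  · rintro ⟨a, b⟩ ⟨c, d⟩ h
    unfold f4 at h
    split_ifs at h <;> simp [Prod.ext_iff] at * <;> omega
  · rintro ⟨r, s⟩
    rcases Int.emod_two_eq_zero_or_one (r - s) with h | h
    · refine ⟨(r - s, (r + s) / 2), ?_⟩
      unfold f4
      rw [if_pos (by simpa using h)]
      simp [Prod.ext_iff]; omega
    · refine ⟨(s - r, (-(r + s) - 1) / 2), ?_⟩
      unfold f4
      rw [if_neg (by simp; omega)]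
      simp [Prod.ext_iff]; omega

theorem F4 {m : ℕ} (hm : 0 < m) : ph m * D (ps (2 * m)) + C ((m:ℚ) / 4) * (ph m * ps (2 * m))
    - ps (2 * m) * D (ph m) = C ((m:ℚ) / 4) * J m ^ 2 := by
  have hp := good_ph hm
  have hs := good_ps (show 0 < 2 * m by omega)
  have hj := good_ps hm
  have e : ph m * D (ps (2 * m)) + C ((m:ℚ) / 4) * (ph m * ps (2 * m))
    - ps (2 * m) * D (ph m) = ph m * D (ps (2 * m)) + C ((m:ℚ) / 4) * (ph m * ps (2 * m))
    + C (-1) * (D (ph m) * ps (2 * m)) := by simp only [map_neg, map_one]; ring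
  rw [e]
  unfold ph ps J
  rw [D_Th hs, D_Th hp, Th_mul hp hs, Th_mul hp hs, Th_mul hp hs, Th_smul (hp.prod hs),
    Th_smul (hp.prod hs), Th_add (hp.prod hs), Th_add (hp.prod hs), pow_two, Th_mul hj hj,
    Th_smul (hj.prod hj)]
  symm
  refine Th_bij f4 f4_bij ?_ ?_
  · rintro ⟨x, n⟩
    unfold f4
    split_ifs with h
    · obtain ⟨t, rfl⟩ : ∃ t, x = 2 * t := ⟨x / 2, by simp at h; omega⟩
      simp only [Int.mul_ediv_cancel_left _ (two_ne_zero)]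
      push_cast; ring
    · obtain ⟨t, rfl⟩ : ∃ t, x = 2 * t + 1 := ⟨x / 2, by simp at h; omega⟩
      simp only [show (2 * t + 1) / 2 = t by omega]
      push_cast; ring
  · rintro ⟨x, n⟩
    unfold f4
    split_ifs with h
    · obtain ⟨t, rfl⟩ : ∃ t, x = 2 * t := ⟨x / 2, by simp at h; omega⟩
      simp only [Int.mul_ediv_cancel_left _ (two_ne_zero)]
      push_cast; ring
    · obtain ⟨t, rfl⟩ : ∃ t, x = 2 * t + 1 := ⟨x / 2, by simp at h; omega⟩
      simp only [show (2 * t + 1) / 2 = t by omega]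
      push_cast; ring

def Nm (a b : ℤ) : ℤ := a ^ 2 + a * b + 2 * b ^ 2

theorem good_Nm {c : ℕ} (hc : 0 < c) : Good (fun p : ℤ × ℤ => (c:ℤ) * Nm p.1 p.2) :=
  (good_Z2 (Q := fun p => Nm p.1 p.2)
    (fun p => by unfold Nm; nlinarith [sq_nonneg (2 * p.1 + p.2), sq_nonneg p.2])
    (fun p => by unfold Nm; nlinarith [sq_nonneg (3 * p.1 + 2 * p.2), sq_nonneg p.2])
    (fun p => by unfold Nm; nlinarith [sq_nonneg (2 * p.1 + p.2), sq_nonneg p.2])).smul (by omega)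

noncomputable def S (c : ℕ) : R := Th (fun p : ℤ × ℤ => (c:ℤ) * Nm p.1 p.2) (fun _ => 1)
noncomputable def od (c : ℕ) : R := Th (fun p : ℤ × ℤ => (c:ℤ) * Nm (2 * p.1 + 1) p.2) (fun _ => 1)
noncomputable def oe (c : ℕ) : R := Th (fun p : ℤ × ℤ => (c:ℤ) * Nm (2 * p.1 + 1) (2 * p.2)) (fun _ => 1)
noncomputable def oo (c : ℕ) : R :=
  Th (fun p : ℤ × ℤ => (c:ℤ) * Nm (2 * p.1 + 1) (2 * p.2 + 1)) (fun _ => 1)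

theorem S_od {c : ℕ} (hc : 0 < c) : S c = S (2 * c) + od c := by
  rw [S, Th_split (good_Nm hc) _ _ _ bij_even_left]
  congr 1
  refine Th_bij Prod.swap Prod.swap_bijective (fun p => ?_) (fun _ => rfl)
  simp only [Prod.fst_swap, Prod.snd_swap, Nm]; push_cast; ring

theorem od_split {c : ℕ} (hc : 0 < c) : od c = oe c + oo c := by
  have hg := (good_Nm hc).comp (bij_even_left.1.comp Sum.inr_injective)
  exact Th_split hg (fun _ => 1) _ _ bij_even_right

theorem od_two {c : ℕ} : od (2 * c) = oo c := by
  symm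
  refine Th_bij (fun p : ℤ × ℤ => (-p.2 - p.1 - 1, p.1)) ?_ (fun p => ?_) (fun _ => rfl)
  · constructor
    · rintro ⟨a, b⟩ ⟨c, d⟩ h; simp [Prod.ext_iff] at h ⊢; omega
    · rintro ⟨a, b⟩; exact ⟨(b, -a - b - 1), by simp [Prod.ext_iff]; omega⟩
  · simp only [Nm]; push_cast; ring

theorem ph_two {c : ℕ} (hc : 0 < c) : ph c * ph (7 * c) = S (4 * c) + oe c := by
  unfold ph
  rw [Th_mul (good_ph hc) (good_ph (by omega)), Th_split ((good_ph hc).prod (good_ph (by omega))) _ _ _ bij_par2]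
  congr 1 <;> refine Th_congr (fun p => ?_) (fun _ => by ring) <;> simp only [Nm] <;> push_cast <;> ring

theorem pm_two {c : ℕ} (hc : 0 < c) : pm c * pm (7 * c) = S (4 * c) - oe c := by
  have hg := (good_ph hc).prod (good_ph (show 0 < 7 * c by omega))
  have : S (4 * c) - oe c = S (4 * c) + C (-1) * oe c := by simp only [map_neg, map_one]; ring
  have hg2 : Good (fun p : ℤ × ℤ => (c:ℤ) * Nm (2 * p.1 + 1) (2 * p.2)) := by
    refine (hg.comp (bij_par2.1.comp Sum.inr_injective)).congr (fun p => ?_)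
    simp only [Nm, Function.comp, Sum.elim_inr]; push_cast; ring
  unfold pm
  rw [this, Th_mul (good_ph hc) (good_ph (by omega)), Th_split hg _ _ _ bij_par2]
  unfold oe
  rw [Th_smul hg2]
  congr 1 <;> refine Th_congr (fun p => ?_) (fun p => ?_)
  · simp only [Nm]; push_cast; ring
  · rw [sg_add, sg_even]; simp only; omega
  · simp only [Nm]; push_cast; ring
  · rw [sg_add, sg_odd]; ring; simp only; omega

theorem S_G : od 1 + S 2 = S 2 + 2 * X * ps 1 * ps 7 := by
  have h := S_od (c := 1) one_pos
  have : S 1 = S 2 + (X ^ 1 * (ps 1 * ps 7) + X ^ 1 * (ps 1 * ps 7)) := by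
    have hb : (Sum.elim (fun p : ℤ × ℤ => (2 * p.2 - p.1, p.1)) (Sum.elim
        (fun p : ℤ × ℤ => (p.1 + 3 * p.2 + 1, p.2 - p.1))
        (fun p : ℤ × ℤ => (-(p.1 + 3 * p.2 + 1), -(p.2 - p.1))))).Bijective := by
      constructor
      · rintro (⟨a, b⟩ | ⟨a, b⟩ | ⟨a, b⟩) (⟨c, d⟩ | ⟨c, d⟩ | ⟨c, d⟩) h <;>
          simp [Prod.ext_iff] at h ⊢ <;> omega
      · rintro ⟨x, y⟩
        rcases Int.emod_two_eq_zero_or_one (x + y) with h | h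
        · exact ⟨.inl (y, (x + y) / 2), by simp [Prod.ext_iff]; omega⟩
        · by_cases h4 : (x + y) % 4 = 1
          · exact ⟨.inr (.inl ((x + y - 1) / 4 - y, (x + y - 1) / 4)), by simp [Prod.ext_iff]; omega⟩
          · exact ⟨.inr (.inr ((-x - y - 1) / 4 + y, (-x - y - 1) / 4)), by simp [Prod.ext_iff]; omega⟩
    rw [S, Th_split (good_Nm one_pos) _ _ _ hb]
    have hp := good_ps (m := 1) one_pos
    have hp7 := good_ps (m := 7) (by norm_num)
    congr 1
    · refine Th_bij (fun p : ℤ × ℤ => (p.1, -p.2)) ?_ (fun p => ?_) (fun _ => rfl)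
      · constructor
        · rintro ⟨a, b⟩ ⟨c, d⟩ h; simp [Prod.ext_iff] at h ⊢; omega
        · rintro ⟨a, b⟩; exact ⟨(a, -b), by simp⟩
      · simp only [Nm]; push_cast; ring
    · have hg2 : Good (fun i : (ℤ × ℤ) ⊕ (ℤ × ℤ) => ((1 : ℕ) : ℤ) * Nm (Sum.elim
        (fun p : ℤ × ℤ => (p.1 + 3 * p.2 + 1, p.2 - p.1))
        (fun p : ℤ × ℤ => (-(p.1 + 3 * p.2 + 1), -(p.2 - p.1))) i).1 (Sum.elim
        (fun p : ℤ × ℤ => (p.1 + 3 * p.2 + 1, p.2 - p.1))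
        (fun p : ℤ × ℤ => (-(p.1 + 3 * p.2 + 1), -(p.2 - p.1))) i).2) :=
        (good_Nm one_pos).comp (hb.1.comp Sum.inr_injective)
      rw [Th_sum hg2]
      unfold ps
      rw [Th_mul hp hp7, Th_X (hp.prod hp7)]
      congr 1 <;> refine Th_congr (fun p => ?_) (fun p => by ring) <;>
        simp only [Nm, Sum.elim_inl, Sum.elim_inr, Function.comp] <;> push_cast <;> ring
  rw [this] at h
  linear_combination -h

theorem T1 : ph 1 * ph 7 = 2 * X * ps 1 * ps 7 + pm 2 * pm 14 := by
  have a1 := S_od (c := 1) (by norm_num)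
  have a2 := S_od (c := 2) (by norm_num)
  have a4 := S_od (c := 4) (by norm_num)
  have b1 := od_split (c := 1) (by norm_num)
  have b2 := od_split (c := 2) (by norm_num)
  have c1 := od_two (c := 1)
  have c2 := od_two (c := 2)
  have d1 := ph_two (c := 1) (by norm_num)
  have d3 := pm_two (c := 2) (by norm_num)
  have g := S_G
  norm_num at *
  linear_combination d1 - d3 + g + a4 - b1 - b2 + c1 + c2

end T7

namespace T7
open PowerSeries

theorem alg1 (u t s x y : R) (hst : s * t = 1) (hI : x + 7 * y = u * (t + 7 * s))
    (hxy : x * y = u ^ 8) (hc : t * y + s * x = 1 + u ^ 8 - (1 - u) ^ 8) :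
    (x - u * t - 7 * (u * (1 - u) * (1 - u * (1 - u)))) *
      (x - u * t + 7 * (u * (1 - u) * (1 - u * (1 - u)))) = 0 := by
  linear_combination (x - u * t) * hI - 7 * hxy + 7 * u * hc - 7 * u ^ 2 * hst

theorem alg2 (u t s x y : R) (hst : s * t = 1) (hI : x + 7 * y = u * (t + 7 * s))
    (hc : t * y + s * x = 1 + u ^ 8 - (1 - u) ^ 8)
    (hx : x = u * t + 7 * (u * (1 - u) * (1 - u * (1 - u))))
    (h0 : u * (1 - u) * (1 - u * (1 - u)) ≠ 0) :
    t - 7 * s = 2 * (-3 + 8 * u - 6 * u ^ 2 + 4 * u ^ 3) := by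
  have hy : 7 * (y - (u * s - u * (1 - u) * (1 - u * (1 - u)))) = 0 := by
    linear_combination hI - hx
  have h7 : (7 : R) ≠ 0 := fun h => by
    have := congrArg constantCoeff h
    rw [map_ofNat, map_zero] at this; norm_num at this
  have hy' := (mul_eq_zero.1 hy).resolve_left h7
  refine mul_left_cancel₀ h0 ?_
  linear_combination (-1) * hc + t * hy' + s * hx + 2 * u * hst

theorem alg3 (u t s x : R) (hst : s * t = 1)
    (hx : x = u * t + 7 * (u * (1 - u) * (1 - u * (1 - u))))
    (hk : t - 7 * s = 2 * (-3 + 8 * u - 6 * u ^ 2 + 4 * u ^ 3)) :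
    (s - (1 - 2 * u)) ^ 3 * (x * (t - x) * t) = 64 * (u * (1 - u)) ^ 7 := by
  have ht : t ^ 2 = 2 * (-3 + 8 * u - 6 * u ^ 2 + 4 * u ^ 3) * t + 7 := by
    linear_combination t * hk + 7 * hst
  have h7 : (7 ^ 3 : R) ≠ 0 := fun h => by
    have := congrArg constantCoeff h
    rw [map_pow, map_ofNat, map_zero] at this; norm_num at this
  refine mul_left_cancel₀ h7 ?_
  have e : 7 ^ 3 * ((s - (1 - 2 * u)) ^ 3 * (x * (t - x) * t)) =
      (7 * s - 7 * (1 - 2 * u)) ^ 3 * (x * (t - x) * t) := by ring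
  have hs : 7 * s = t - 2 * (-3 + 8 * u - 6 * u ^ 2 + 4 * u ^ 3) := by linear_combination -hk
  rw [e, hs, hx]
  linear_combination (((3136) * u ^ 7 + (-21952) * u ^ 8 + (65856) * u ^ 9 + (-109760) * u ^ 10 + (109760) * u ^ 11 + (-65856) * u ^ 12 + (21952) * u ^ 13 + (-3136) * u ^ 14) + ((-7) * u ^ 2 + (-14) * u ^ 3 + (280) * u ^ 4 + (-154) * u ^ 5 + (-4116) * u ^ 6 + (15036) * u ^ 7 + (-24255) * u ^ 8 + (20790) * u ^ 9 + (-9240) * u ^ 10 + (1680) * u ^ 11) * t + (u + (17) * u ^ 2 + (-38) * u ^ 3 + (-313) * u ^ 4 + (1342) * u ^ 5 + (-2020) * u ^ 6 + (1348) * u ^ 7 + (-337) * u ^ 8) * t ^ 2 + ((-2) * u + (-9) * u ^ 2 + (56) * u ^ 3 + (-75) * u ^ 4 + (30) * u ^ 5) * t ^ 3 + (u - u ^ 2) * t ^ 4) * ht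

theorem pr_cc (ε : ℚ) (m r : ℕ) : constantCoeff (pr ε m r) = 1 := by
  rw [← coeff_zero_eq_constantCoeff_apply, pr, coeff_mk]; simp [prf]

theorem ph_cc {m : ℕ} (hm : 0 < m) : constantCoeff (ph m) = 1 := by
  rw [ph_prod hm]; simp [E, P, pr_cc]
theorem pm_cc {m : ℕ} (hm : 0 < m) : constantCoeff (pm m) = 1 := by
  rw [pm_prod hm]; simp [E, Mi, pr_cc]
theorem ps_cc {m : ℕ} (hm : 0 < m) : constantCoeff (ps m) = 1 := by
  rw [ps_prod hm]; simp [E, P, pr_cc]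
theorem fr_cc {r : ℕ} (hr : 0 < r) (h : r < 14) : constantCoeff (fr r) = 1 := by
  rw [fr_prod (s := 14 - r) hr (by omega) (by omega)]; simp [E, pr_cc]

theorem ne_of_cc {f : R} (h : constantCoeff f = 1) : f ≠ 0 := by
  rintro rfl; simp at h

theorem ex_log {f : R} (h : constantCoeff f = 1) : ∃ l, D f = f * l := by
  refine ⟨f⁻¹ * D f, ?_⟩
  rw [← mul_assoc, PowerSeries.mul_inv_cancel _ (by rw [h]; exact one_ne_zero), one_mul]

theorem DX : D (X : R) = X := by
  rw [D, Derivation.smul_apply]; simp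

theorem C_quarter (m : ℕ) : C ((m:ℚ) / 4) * 4 = (m : R) := by
  have : (4 : R) = C (4:ℚ) := (map_ofNat C 4).symm
  rw [this, ← map_mul, div_mul_cancel₀ _ (by norm_num)]; simp

theorem D_four {f l : R} (h : D f = f * l) : D (f ^ 4) = 4 * f ^ 4 * l := by
  rw [Derivation.leibniz_pow, h]; simp; ring

/-- logarithmic derivatives -/
theorem logs {m : ℕ} (hm : 0 < m) {a b c d h : R}
    (ha : D (ph m) = ph m * a) (hb : D (pm m) = pm m * b) (hc : D (ps m) = ps m * c)
    (hd : D (ps (2 * m)) = ps (2 * m) * d) (hh : D (pm (2 * m)) = pm (2 * m) * h) :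
    8 * c = 8 * a + m * (pm m ^ 4 - 1) ∧ 8 * h = 8 * a - (m : R) * (16 * X ^ m * ps (2 * m) ^ 4) := by
  have hm2 : 0 < 2 * m := by omega
  have nph := ne_of_cc (ph_cc hm)
  have npm := ne_of_cc (pm_cc hm)
  have nps := ne_of_cc (ps_cc hm)
  have nps2 := ne_of_cc (ps_cc hm2)
  have npm2 := ne_of_cc (pm_cc hm2)
  have f1 := F1 hm
  have f2 := F2 hm
  have f3 := F3 hm
  have f4 := F4 hm
  have f5 := F5 hm
  have q := C_quarter m
  have e4 : 4 * d + m - 4 * a = m * pm m ^ 4 := by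
    refine mul_left_cancel₀ (mul_ne_zero nph nps2) ?_
    rw [f5, hd, ha] at f4
    linear_combination 4 * f4 + (ps m ^ 2 * pm m ^ 4 - ph m * ps (2 * m)) * q + m * pm m ^ 4 * f2
  have e2 : 2 * c = a + d := by
    have := congrArg D f2
    simp only [Derivation.leibniz, Derivation.leibniz_pow, smul_eq_mul, ha, hd, hc] at this
    refine mul_left_cancel₀ (mul_ne_zero nph nps2) ?_
    simp at this
    linear_combination this - 2 * c * f2
  have e1 : 2 * h = a + b := by
    have := congrArg D f1
    simp only [Derivation.leibniz, Derivation.leibniz_pow, smul_eq_mul, ha, hb, hh] at this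
    refine mul_left_cancel₀ (mul_ne_zero nph npm) ?_
    simp at this
    linear_combination this - 2 * h * f1
  have e3 : 4 * b = 4 * a - (m : R) * (16 * X ^ m * ps (2 * m) ^ 4) := by
    have := congrArg D f3
    have h16 : D (16 : R) = 0 := by
      have : (16 : R) = algebraMap ℚ R 16 := (map_ofNat (algebraMap ℚ R) 16).symm
      rw [this, Derivation.map_algebraMap]
    have hX : D ((X : R) ^ m) = (m : R) * (X : R) ^ m := by
      rw [Derivation.leibniz_pow, DX]
      obtain ⟨n, rfl⟩ : ∃ n, m = n + 1 := ⟨m - 1, by omega⟩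
      simp [pow_succ]
    rw [map_add, Derivation.leibniz, Derivation.leibniz, D_four ha, D_four hb, D_four hd, h16, hX] at this
    simp only [smul_eq_mul] at this
    refine mul_left_cancel₀ (pow_ne_zero 4 npm) ?_
    linear_combination (-1) * this + 4 * a * f3 - 16 * (X : R) ^ m * ps (2 * m) ^ 4 * e4
  constructor
  · linear_combination 4 * e2 + e4
  · linear_combination 4 * e1 + e3

theorem key1 : 2 * X * ps 1 * ps 7 * (ph 1 ^ 4 + 7 * ph 7 ^ 4) =
    ph 1 * ph 7 * (16 * X * ps 2 ^ 4 + 7 * (16 * X ^ 7 * ps 14 ^ 4)) := by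
  obtain ⟨a, ha⟩ := ex_log (ph_cc (m := 1) (by norm_num))
  obtain ⟨b, hb⟩ := ex_log (pm_cc (m := 1) (by norm_num))
  obtain ⟨c, hc⟩ := ex_log (ps_cc (m := 1) (by norm_num))
  obtain ⟨d, hd⟩ := ex_log (ps_cc (m := 2 * 1) (by norm_num))
  obtain ⟨h, hh⟩ := ex_log (pm_cc (m := 2 * 1) (by norm_num))
  obtain ⟨a', ha'⟩ := ex_log (ph_cc (m := 7) (by norm_num))
  obtain ⟨b', hb'⟩ := ex_log (pm_cc (m := 7) (by norm_num))
  obtain ⟨c', hc'⟩ := ex_log (ps_cc (m := 7) (by norm_num))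
  obtain ⟨d', hd'⟩ := ex_log (ps_cc (m := 2 * 7) (by norm_num))
  obtain ⟨h', hh'⟩ := ex_log (pm_cc (m := 2 * 7) (by norm_num))
  obtain ⟨l1, l2⟩ := logs (by norm_num) ha hb hc hd hh
  obtain ⟨l3, l4⟩ := logs (by norm_num) ha' hb' hc' hd' hh'
  have g1 := F3 (m := 1) (by norm_num)
  have g7 := F3 (m := 7) (by norm_num)
  have t1 := T1
  have h2 : D (2 : R) = 0 := by
    have : (2 : R) = algebraMap ℚ R 2 := (map_ofNat (algebraMap ℚ R) 2).symm
    rw [this, Derivation.map_algebraMap]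
  have := congrArg D t1
  norm_num at *
  simp only [Derivation.leibniz, smul_eq_mul, ha, ha', hc, hc', hh, hh', DX, h2] at this
  linear_combination (-8) * this - 2 * X * ps 1 * ps 7 * (l1 + l3) - pm 2 * pm 14 * (l2 + l4)
    + 8 * (a + a') * t1 - (16 * X * ps 2 ^ 4 + 7 * (16 * X ^ 7 * ps 14 ^ 4)) * t1
    + 2 * X * ps 1 * ps 7 * (g1 + 7 * g7)

end T7

namespace T7
open PowerSeries

theorem ne_cc {f : R} {c : ℚ} (h : constantCoeff f = c) (hc : c ≠ 0) : f ≠ 0 := by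
  rintro rfl; rw [map_zero] at h; exact hc h.symm

theorem Kcube {A B A' B' p1 p2 p7 p14 h2 h14 : R}
    (cA : constantCoeff A = 1) (cB : constantCoeff B = 1)
    (cp1 : constantCoeff p1 = 1) (cp2 : constantCoeff p2 = 1) (cp7 : constantCoeff p7 = 1)
    (ch2 : constantCoeff h2 = 1) (ch14 : constantCoeff h14 = 1)
    (f11 : h2 ^ 2 = A * A') (f17 : h14 ^ 2 = B * B')
    (f21 : p1 ^ 2 = A * p2) (f27 : p7 ^ 2 = B * p14)
    (f31 : A ^ 4 = A' ^ 4 + 16 * X * p2 ^ 4) (f37 : B ^ 4 = B' ^ 4 + 16 * X ^ 7 * p14 ^ 4)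
    (t1 : A * B = 2 * X * p1 * p7 + h2 * h14)
    (k1 : 2 * X * p1 * p7 * (A ^ 4 + 7 * B ^ 4) =
      A * B * (16 * X * p2 ^ 4 + 7 * (16 * X ^ 7 * p14 ^ 4))) :
    (B ^ 4 - A * B * (h2 * h14 - 2 * X * p1 * p7)) ^ 3 * (16 * X * p2 ^ 4 * A' ^ 4 * A ^ 4 * (A * B) ^ 2)
      = 64 * (2 * X * p1 * p7 * (h2 * h14)) ^ 7 := by
  obtain ⟨I, hI⟩ : ∃ I, A * B * I = 1 := ⟨(A * B)⁻¹, PowerSeries.mul_inv_cancel _ (by simp [cA, cB])⟩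
  have cI : constantCoeff I = 1 := by
    have := congrArg constantCoeff hI
    simpa [cA, cB] using this
  set x := 16 * X * p2 ^ 4 with hx
  set y := 16 * X ^ 7 * p14 ^ 4 with hy
  set G := 2 * X * p1 * p7 with hG
  set H := h2 * h14 with hH
  have G8 : G ^ 8 = x * y * (A * B) ^ 4 := by
    calc G ^ 8 = 256 * X ^ 8 * (p1 ^ 2) ^ 4 * (p7 ^ 2) ^ 4 := by rw [hG]; ring
      _ = _ := by rw [f21, f27, hx, hy]; ring
  have H8 : H ^ 8 = A' ^ 4 * B' ^ 4 * (A * B) ^ 4 := by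
    calc H ^ 8 = (h2 ^ 2) ^ 4 * (h14 ^ 2) ^ 4 := by rw [hH]; ring
      _ = _ := by rw [f11, f17]; ring
  have hI4 : (A * B * I) ^ 4 = 1 := by rw [hI]; ring
  have hv : 1 - G * I = H * I := by linear_combination I * t1 - hI
  have hst : (B ^ 4 * I ^ 2) * (A ^ 4 * I ^ 2) = 1 := by linear_combination hI4
  have hII : x * I ^ 2 + 7 * (y * I ^ 2) = G * I * (A ^ 4 * I ^ 2 + 7 * (B ^ 4 * I ^ 2)) := by
    linear_combination (-I ^ 3) * k1 - (x * I ^ 2 + 7 * (y * I ^ 2)) * hI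
  have hxy : (x * I ^ 2) * (y * I ^ 2) = (G * I) ^ 8 := by
    rw [mul_pow, G8]; linear_combination (-x * y * I ^ 4) * hI4
  have hc : (A ^ 4 * I ^ 2) * (y * I ^ 2) + (B ^ 4 * I ^ 2) * (x * I ^ 2) =
      1 + (G * I) ^ 8 - (1 - G * I) ^ 8 := by
    rw [hv, ← hxy, mul_pow H, H8]
    have e : A' ^ 4 * B' ^ 4 = (A ^ 4 - x) * (B ^ 4 - y) := by rw [f31, f37]; ring
    rw [e]
    linear_combination ((A ^ 4 - x) * (B ^ 4 - y) * I ^ 4 + 1) * hI4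
  have a1 := alg1 _ _ _ _ _ hst hII hxy hc
  have hx' : x * I ^ 2 = G * I * (A ^ 4 * I ^ 2) +
      7 * (G * I * (1 - G * I) * (1 - G * I * (1 - G * I))) := by
    rcases mul_eq_zero.1 a1 with h | h
    · linear_combination h
    · exfalso
      have e : X * (16 * p2 ^ 4 * I ^ 2 - 2 * p1 * p7 * I * (A ^ 4 * I ^ 2) +
        7 * (2 * p1 * p7 * I * (1 - G * I) * (1 - G * I * (1 - G * I)))) = 0 := by
        rw [← h, hx, hG]; ring
      rcases mul_eq_zero.1 e with e | e
      · exact X_ne_zero e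
      · have := congrArg constantCoeff e
        simp [cA, cp2, cp1, cp7, cI, hG] at this
        rw [map_ofNat, map_ofNat, map_ofNat] at this
        norm_num at this
  have hg0 : G * I * (1 - G * I) * (1 - G * I * (1 - G * I)) ≠ 0 := by
    intro h
    have e : X * (2 * p1 * p7 * I * (1 - G * I) * (1 - G * I * (1 - G * I))) = 0 := by
      rw [← h, hG]; ring
    rcases mul_eq_zero.1 e with e | e
    · exact X_ne_zero e
    · have := congrArg constantCoeff e
      simp [cp1, cp7, cI, hG] at this
      rw [map_ofNat] at this
      norm_num at this
  have hk := alg2 _ _ _ _ _ hst hII hc hx' hg0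
  have h3 := alg3 _ _ _ _ hst hx' hk
  have hI2 : (A * B * I) ^ 2 = 1 := by rw [hI]; ring
  have e1 : (A * B) ^ 2 * (B ^ 4 * I ^ 2 - (1 - 2 * (G * I))) = B ^ 4 - A * B * (H - G) := by
    linear_combination B ^ 4 * hI2 + 2 * (A * B * G) * hI - A * B * t1
  have e2 : (A * B) ^ 2 * (A ^ 4 * I ^ 2 - x * I ^ 2) = A' ^ 4 := by
    linear_combination (A ^ 4 - x) * hI2 + f31
  have e3 : (A * B) ^ 2 * (x * I ^ 2) = x := by linear_combination x * hI2
  have e4 : (A * B) ^ 2 * (A ^ 4 * I ^ 2) = A ^ 4 := by linear_combination A ^ 4 * hI2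
  have e5 : (A * B) ^ 2 * (G * I * (1 - G * I)) = G * H := by
    rw [hv]; linear_combination G * H * hI2
  rw [← e1]
  calc _ = ((A * B) ^ 2) ^ 3 * (B ^ 4 * I ^ 2 - (1 - 2 * (G * I))) ^ 3 * (x * A' ^ 4 * A ^ 4) * (A * B) ^ 2 := by
        ring
    _ = ((A * B) ^ 2) ^ 3 * (B ^ 4 * I ^ 2 - (1 - 2 * (G * I))) ^ 3 * (((A * B) ^ 2 * (x * I ^ 2)) *
        ((A * B) ^ 2 * (A ^ 4 * I ^ 2 - x * I ^ 2)) * ((A * B) ^ 2 * (A ^ 4 * I ^ 2))) * (A * B) ^ 2 := by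
        rw [e2, e3, e4]
    _ = ((A * B) ^ 2) ^ 7 * ((B ^ 4 * I ^ 2 - (1 - 2 * (G * I))) ^ 3 * (x * I ^ 2 *
        (A ^ 4 * I ^ 2 - x * I ^ 2) * (A ^ 4 * I ^ 2))) := by ring
    _ = 64 * ((A * B) ^ 2 * (G * I * (1 - G * I))) ^ 7 := by rw [h3]; ring
    _ = _ := by rw [e5]

theorem two_ne : (2 : R) ≠ 0 := fun h => by
  have := congrArg constantCoeff h
  rw [map_ofNat, map_zero] at this; norm_num at this

theorem Kfin {A B A' B' p1 p2 p7 p14 h2 h14 f Q : R}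
    (cA : constantCoeff A = 1) (cB : constantCoeff B = 1) (cA' : constantCoeff A' = 1)
    (cp1 : constantCoeff p1 = 1) (cp2 : constantCoeff p2 = 1) (cp7 : constantCoeff p7 = 1)
    (ch2 : constantCoeff h2 = 1) (ch14 : constantCoeff h14 = 1) (cf : constantCoeff f = 1)
    (f11 : h2 ^ 2 = A * A') (f17 : h14 ^ 2 = B * B')
    (f21 : p1 ^ 2 = A * p2) (f27 : p7 ^ 2 = B * p14)
    (t5 : f ^ 6 * B ^ 3 * (p2 * h2 ^ 2) = (p14 * h14 ^ 2) ^ 7 * A ^ 3)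
    (hQ : Q ^ 3 * (16 * X * p2 ^ 4 * A' ^ 4 * A ^ 4 * (A * B) ^ 2)
      = 64 * (2 * X * p1 * p7 * (h2 * h14)) ^ 7) :
    Q = 8 * X ^ 2 * f * B := by
  have nA : A ≠ 0 := ne_of_cc cA
  have nB : B ≠ 0 := ne_of_cc cB
  have nA' : A' ≠ 0 := ne_of_cc cA'
  have np2 : p2 ≠ 0 := ne_of_cc cp2
  have nX : (X : R) ≠ 0 := X_ne_zero
  have h6 : Q ^ 6 = (8 * X ^ 2 * f * B) ^ 6 := by
    have n0 : (256 * X ^ 2 * p2 ^ 8 * A' ^ 8 * A ^ 12 * B ^ 4 : R) ≠ 0 := by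
      have : (256 : R) ≠ 0 := by
        rw [show (256 : R) = 2 ^ 8 by norm_num]; exact pow_ne_zero _ two_ne
      simp [*]
    refine mul_left_cancel₀ n0 ?_
    calc _ = (Q ^ 3 * (16 * X * p2 ^ 4 * A' ^ 4 * A ^ 4 * (A * B) ^ 2)) ^ 2 := by ring
      _ = 2 ^ 26 * X ^ 14 * (p1 ^ 2) ^ 7 * (p7 ^ 2) ^ 7 * (h2 ^ 2) ^ 7 * (h14 ^ 2) ^ 7 := by
        rw [hQ]; ring
      _ = 2 ^ 26 * X ^ 14 * (A * p2) ^ 7 * (A * A') ^ 7 * B ^ 7 * (p14 * h14 ^ 2) ^ 7 := by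
        rw [f21, f27, f11]; ring
      _ = 2 ^ 26 * X ^ 14 * p2 ^ 7 * A ^ 11 * A' ^ 7 * B ^ 7 * ((p14 * h14 ^ 2) ^ 7 * A ^ 3) := by ring
      _ = _ := by rw [← t5, f11]; ring
  have h3 : Q ^ 3 = (8 * X ^ 2 * f * B) ^ 3 := by
    have : (Q ^ 3 - (8 * X ^ 2 * f * B) ^ 3) * (Q ^ 3 + (8 * X ^ 2 * f * B) ^ 3) = 0 := by
      linear_combination h6
    rcases mul_eq_zero.1 this with h | h
    · linear_combination h
    · exfalso
      have e : Q ^ 3 = - (8 * X ^ 2 * f * B) ^ 3 := by linear_combination h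
      rw [e] at hQ
      have e2 : (2 ^ 13 * X ^ 7 : R) * (p1 ^ 7 * p7 ^ 7 * (h2 * h14) ^ 7 + f ^ 3 * B ^ 3 *
          (p2 ^ 4 * A' ^ 4 * A ^ 4 * (A * B) ^ 2)) = 0 := by
        linear_combination -hQ
      rcases mul_eq_zero.1 e2 with e3 | e3
      · exact (mul_ne_zero (pow_ne_zero 13 two_ne) (pow_ne_zero 7 nX)) e3
      · have := congrArg constantCoeff e3
        simp [cA, cB, cA', cp1, cp2, cp7, ch2, ch14, cf] at this
  obtain ⟨Q1, rfl⟩ : X ∣ Q := (X_prime).dvd_of_dvd_pow (n := 3) ⟨512 * X ^ 5 * f ^ 3 * B ^ 3, by rw [h3]; ring⟩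
  have h3' : Q1 ^ 3 = (8 * X * f * B) ^ 3 := by
    refine mul_left_cancel₀ (pow_ne_zero 3 nX) ?_
    linear_combination h3
  obtain ⟨Q2, rfl⟩ : X ∣ Q1 := (X_prime).dvd_of_dvd_pow (n := 3) ⟨512 * X ^ 2 * f ^ 3 * B ^ 3, by rw [h3']; ring⟩
  have h4 : Q2 ^ 3 = (8 * f * B) ^ 3 := by
    refine mul_left_cancel₀ (pow_ne_zero 3 nX) ?_
    linear_combination h3'
  have : (Q2 - 8 * f * B) * (Q2 ^ 2 + Q2 * (8 * f * B) + (8 * f * B) ^ 2) = 0 := by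
    linear_combination h4
  rcases mul_eq_zero.1 this with h | h
  · linear_combination X ^ 2 * h
  · exfalso
    have := congrArg constantCoeff h
    simp [cB, cf] at this
    rw [map_ofNat] at this
    nlinarith [sq_nonneg (constantCoeff Q2 + 4)]

theorem K : ph 7 ^ 3 - 8 * X ^ 2 * (fr 1 * fr 3 * fr 5) =
    ph 1 * (pm 2 * pm 14 - 2 * X * ps 1 * ps 7) := by
  have f11 := F1 (m := 1) (by norm_num)
  have f17 := F1 (m := 7) (by norm_num)
  have f21 := F2 (m := 1) (by norm_num)
  have f27 := F2 (m := 7) (by norm_num)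
  have f31 := F3 (m := 1) (by norm_num)
  have f37 := F3 (m := 7) (by norm_num)
  have t5 := T5
  rw [F5 (by norm_num), F5 (by norm_num)] at t5
  norm_num at f11 f17 f21 f27 f31 f37
  have hQ := Kcube (ph_cc (by norm_num)) (ph_cc (by norm_num)) (ps_cc (by norm_num)) (ps_cc (by norm_num))
    (ps_cc (by norm_num)) (pm_cc (by norm_num)) (pm_cc (by norm_num)) f11 f17 f21 f27 f31 f37 T1 key1
  have h := Kfin (ph_cc (by norm_num)) (ph_cc (by norm_num)) (pm_cc (by norm_num)) (ps_cc (by norm_num))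
    (ps_cc (by norm_num)) (ps_cc (by norm_num)) (pm_cc (by norm_num)) (pm_cc (by norm_num))
    (f := fr 1 * fr 3 * fr 5) (by simp [fr_cc]) f11 f17 f21 f27 t5 hQ
  refine mul_left_cancel₀ (ne_of_cc (ph_cc (show 0 < 7 by norm_num))) ?_
  linear_combination h

end T7

namespace T7
open PowerSeries

abbrev Z3 := ℤ × ℤ × ℤ

theorem nc {S T : Set Z3} (f : Z3 → Z3) (hi : f.Injective) (h : ∀ x, x ∈ S ↔ f x ∈ T)
    (hs : ∀ y ∈ T, ∃ x, f x = y) : S.ncard = T.ncard := by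
  rw [← Set.ncard_image_of_injective S hi]
  congr 1
  ext y
  constructor
  · rintro ⟨x, hx, rfl⟩; exact (h x).1 hx
  · intro hy
    obtain ⟨x, rfl⟩ := hs y hy
    exact ⟨x, (h x).2 hy, rfl⟩

theorem sq_par (x : ℤ) : (x % 2 = 1 ∧ x ^ 2 % 8 = 1) ∨ (x % 4 = 0 ∧ x ^ 2 % 8 = 0) ∨
    (x % 4 = 2 ∧ x ^ 2 % 8 = 4) := by
  have : x % 8 = 0 ∨ x % 8 = 1 ∨ x % 8 = 2 ∨ x % 8 = 3 ∨ x % 8 = 4 ∨ x % 8 = 5 ∨ x % 8 = 6 ∨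
    x % 8 = 7 := by omega
  rcases this with h | h | h | h | h | h | h | h <;> simp [pow_two, Int.mul_emod, h] <;> omega

theorem par3 {x y z : ℤ} (h : (x ^ 2 + y ^ 2 + z ^ 2) % 8 = 1) :
    (x % 2 = 1 ∧ y % 2 = 0 ∧ z % 2 = 0) ∨ (x % 2 = 0 ∧ y % 2 = 1 ∧ z % 2 = 0) ∨
    (x % 2 = 0 ∧ y % 2 = 0 ∧ z % 2 = 1) := by
  have := sq_par x
  have := sq_par y
  have := sq_par z
  omega

def cyc (p : Z3) : Z3 := (p.2.1, p.2.2, p.1)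

theorem cyc_inj : cyc.Injective := by
  rintro ⟨a, b, c⟩ ⟨a', b', c'⟩ h
  simp only [cyc, Prod.mk.injEq] at h ⊢
  tauto

theorem three {S : Set Z3} (hf : S.Finite) (hc : ∀ p, p ∈ S ↔ cyc p ∈ S)
    (h8 : ∀ p ∈ S, (p.1 ^ 2 + p.2.1 ^ 2 + p.2.2 ^ 2) % 8 = 1) :
    S.ncard = 3 * {p ∈ S | p.1 % 2 = 1}.ncard := by
  have e1 : {p ∈ S | p.2.1 % 2 = 1}.ncard = {p ∈ S | p.1 % 2 = 1}.ncard := by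
    refine nc cyc cyc_inj (fun p => ?_) (fun y _ => ⟨cyc (cyc y), rfl⟩)
    simp only [Set.mem_ofPred_eq, ← hc p]
    rfl
  have e2 : {p ∈ S | p.2.2 % 2 = 1}.ncard = {p ∈ S | p.2.1 % 2 = 1}.ncard := by
    refine nc cyc cyc_inj (fun p => ?_) (fun y _ => ⟨cyc (cyc y), rfl⟩)
    simp only [Set.mem_ofPred_eq, ← hc p]
    rfl
  have hS : S = {p ∈ S | p.1 % 2 = 1} ∪ ({p ∈ S | p.2.1 % 2 = 1} ∪ {p ∈ S | p.2.2 % 2 = 1}) := by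
    ext p
    simp only [Set.mem_union, Set.mem_ofPred_eq]
    constructor
    · intro h
      rcases par3 (h8 p h) with h' | h' | h' <;> simp [h, h']
    · tauto
  have f1 : {p ∈ S | p.1 % 2 = 1}.Finite := hf.subset fun p h => h.1
  have f2 : {p ∈ S | p.2.1 % 2 = 1}.Finite := hf.subset fun p h => h.1
  have f3 : {p ∈ S | p.2.2 % 2 = 1}.Finite := hf.subset fun p h => h.1
  conv_lhs => rw [hS]
  rw [Set.ncard_union_eq _ f1 (f2.union f3), Set.ncard_union_eq _ f2 f3, e2, e1]
  · ring
  · rw [Set.disjoint_left]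
    rintro p ⟨h, h1⟩ ⟨_, h2⟩
    have := par3 (h8 p h); omega
  · rw [Set.disjoint_left]
    rintro p ⟨h, h1⟩ (⟨_, h2⟩ | ⟨_, h2⟩) <;>
    · have := par3 (h8 p h); omega

theorem fin3 (n : ℤ) : {p : Z3 | p.1 ^ 2 + p.2.1 ^ 2 + p.2.2 ^ 2 = n}.Finite := by
  have g : Good (fun x : ℤ => x ^ 2) := (good_ph (m := 1) one_pos).congr (by simp)
  refine ((g.prod (g.prod g)).fin n).subset fun p hp => ?_
  simp only [Set.mem_ofPred_eq] at hp ⊢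
  linarith

/-- The lattice points. -/
def AA (M : ℤ) : Set Z3 := {p | p.1 ^ 2 + p.2.1 ^ 2 + p.2.2 ^ 2 = M ∧ 7 ∣ p.2.1 - 2 * p.1 ∧
  7 ∣ p.2.2 - 4 * p.1}

theorem AA_fin (M : ℤ) : (AA M).Finite := (fin3 M).subset fun _ h => h.1

theorem dvd_sq7 {x m : ℤ} (h : x ^ 2 = 7 * m) : 7 ∣ x :=
  (Int.prime_iff_natAbs_prime.2 (by norm_num)).dvd_of_dvd_pow (n := 2) ⟨m, h⟩

theorem AA_rep {M : ℤ} (h8 : M % 8 = 1) (h7 : 7 ∣ M) : (AA M).ncard = 3 * rep 3 5 14 0 0 2 M := by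
  rw [three (AA_fin M)]
  · congr 1
    trans {p : Z3 | 21 * p.1 ^ 2 - 28 * p.1 * p.2.1 + 42 * p.2.1 ^ 2 + 14 * p.2.2 ^ 2 = M}.ncard
    · symm
      refine nc (fun p => (p.1 + 4 * p.2.1 + 2 * p.2.2, 2 * p.1 + p.2.1 - 3 * p.2.2,
        4 * p.1 - 5 * p.2.1 + p.2.2)) ?_ ?_ ?_
      · rintro ⟨a, b, c⟩ ⟨a', b', c'⟩ h
        simp only [Prod.mk.injEq] at h ⊢
        omega
      · rintro ⟨a, b, c⟩
        simp only [Set.mem_ofPred_eq, AA]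
        have e : (a + 4 * b + 2 * c) ^ 2 + (2 * a + b - 3 * c) ^ 2 + (4 * a - 5 * b + c) ^ 2 =
          21 * a ^ 2 - 28 * a * b + 42 * b ^ 2 + 14 * c ^ 2 := by ring
        rw [← e]
        constructor
        · intro h
          have := par3 (h ▸ h8)
          refine ⟨⟨h, by omega, by omega⟩, by omega⟩
        · exact fun h => h.1.1
      · rintro ⟨x, y, z⟩ h
        simp only [Set.mem_ofPred_eq, AA] at h
        obtain ⟨⟨h, h1, h2⟩, h3⟩ := h
        have := par3 (h ▸ h8)
        refine ⟨((x + y + z) / 7, (2 * x + y - z) / 14, (2 * x - 3 * y + z) / 14), ?_⟩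
        simp only [Prod.mk.injEq, and_true, true_and]
        omega
    · refine nc (fun p => (2 * p.1 + p.2.1, p.1 - 3 * p.2.1, p.2.2)) ?_ ?_ ?_
      · rintro ⟨a, b, c⟩ ⟨a', b', c'⟩ h
        simp only [Prod.mk.injEq] at h ⊢
        omega
      · rintro ⟨a, b, c⟩
        simp only [Set.mem_ofPred_eq]
        constructor <;> intro h <;> linear_combination -h
      · rintro ⟨x, y, z⟩ h
        simp only [Set.mem_ofPred_eq] at h
        obtain ⟨k, rfl⟩ := h7
        obtain ⟨m, hm⟩ := dvd_sq7 (x := 3 * x + y) (m := 3 * k - 2 * y ^ 2 - 6 * z ^ 2) (by linear_combination -3 * h)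
        refine ⟨(m, x - 2 * m, z), ?_⟩
        simp only [Prod.mk.injEq, and_true, true_and]
        omega
  · rintro ⟨x, y, z⟩
    simp only [AA, cyc, Set.mem_ofPred_eq]
    constructor
    · rintro ⟨h, h1, h2⟩; exact ⟨by linarith, by omega, by omega⟩
    · rintro ⟨h, h1, h2⟩; exact ⟨by linarith, by omega, by omega⟩
  · rintro p ⟨h, _⟩; rw [h]; exact h8

end T7

namespace T7
open PowerSeries

theorem c_ph7 (N : ℕ) : coeff N (ph 7 ^ 3) =
    ({p : Z3 | 7 * p.1 ^ 2 + (7 * p.2.1 ^ 2 + 7 * p.2.2 ^ 2) = (N : ℤ)}.ncard : ℚ) := by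
  have g := good_ph (m := 7) (by norm_num)
  rw [show ph 7 ^ 3 = ph 7 * (ph 7 * ph 7) by ring]
  unfold ph
  rw [Th_mul g g, Th_mul g (g.prod g)]
  simp only [mul_one]
  rw [coeff_Th_one (g.prod (g.prod g))]
  norm_num

theorem c_F (N : ℕ) : coeff N (ph 1 * (ph 1 * ph 7)) =
    ({p : Z3 | p.1 ^ 2 + (p.2.1 ^ 2 + 7 * p.2.2 ^ 2) = (N : ℤ)}.ncard : ℚ) := by
  have g := good_ph (m := 7) (by norm_num)
  have g1 := good_ph (m := 1) (by norm_num)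
  unfold ph
  rw [Th_mul g1 g, Th_mul g1 (g1.prod g)]
  simp only [mul_one]
  rw [coeff_Th_one (g1.prod (g1.prod g))]
  norm_num

theorem c_H {N : ℕ} (h8 : N % 8 = 7) : coeff N (ph 1 * (pm 2 * pm 14)) =
    -({p : Z3 | p.1 ^ 2 + (2 * p.2.1 ^ 2 + 14 * p.2.2 ^ 2) = (N : ℤ)}.ncard : ℚ) := by
  have g := good_ph (m := 2) (by norm_num)
  have g' := good_ph (m := 14) (by norm_num)
  have g1 := good_ph (m := 1) (by norm_num)
  have e : coeff N (Th (fun x : Z3 => ((1:ℕ):ℤ) * x.1 ^ 2 + (((2:ℕ):ℤ) * x.2.1 ^ 2 + ((14:ℕ):ℤ) * x.2.2 ^ 2))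
    (fun x => 1 * (sg x.2.1 * sg x.2.2))) = coeff N (C (-1) * (Th (fun x : Z3 => ((1:ℕ):ℤ) * x.1 ^ 2 +
      (((2:ℕ):ℤ) * x.2.1 ^ 2 + ((14:ℕ):ℤ) * x.2.2 ^ 2))
    (fun _ => 1))) := by
    rw [Th_smul (g1.prod (g.prod g')), coeff_Th, coeff_Th]
    refine finsum_mem_congr rfl ?_
    rintro ⟨x, y, z⟩ h
    simp only [Set.mem_ofPred_eq] at h
    have hx := sq_par x
    have hy := sq_par y
    have hz := sq_par z
    push_cast at h
    rw [sg_add]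
    simp only [one_mul, mul_one]
    apply sg_odd
    omega
  unfold ph pm
  rw [Th_mul g g', Th_mul g1 (g.prod g'), e, coeff_C_mul, coeff_Th_one (g1.prod (g.prod g'))]
  norm_num

theorem good_fr (r : ℕ) (h0 : 0 < r) (h : r < 7) : Good (fun k : ℤ => 7 * k ^ 2 - 7 * k + r * k) := by
  have h1 : (r : ℤ) ≤ 6 := by exact_mod_cast (by omega : r ≤ 6)
  have h2 : (1:ℤ) ≤ r := by exact_mod_cast h0
  have key : ∀ k : ℤ, 0 ≤ k * (7 * k - 7 + r) := fun k => by
    rcases le_or_gt k 0 with hk | hk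
    · exact mul_nonneg_of_nonpos_of_nonpos hk (by linarith)
    · exact mul_nonneg hk.le (by linarith)
  refine good_Z (fun k => by linarith [key k]) (fun k => ?_)
  rcases le_or_gt k 0 with hk | hk
  · nlinarith [key k]
  · nlinarith [key k]

def BB (N : ℤ) : Set Z3 := {p | 7 * p.1 ^ 2 - 7 * p.1 + 1 * p.1 + (7 * p.2.1 ^ 2 - 7 * p.2.1 + 3 * p.2.1 +
  (7 * p.2.2 ^ 2 - 7 * p.2.2 + 5 * p.2.2)) + 2 = N}

theorem c_fr (N : ℕ) : coeff N (X ^ 2 * (fr 1 * fr 3 * fr 5)) = ((BB N).ncard : ℚ) := by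
  have g1 := good_fr 1 (by norm_num) (by norm_num)
  have g3 := good_fr 3 (by norm_num) (by norm_num)
  have g5 := good_fr 5 (by norm_num) (by norm_num)
  rw [mul_assoc (fr 1)]
  unfold fr
  rw [Th_mul g3 g5, Th_mul g1 (g3.prod g5), Th_X (g1.prod (g3.prod g5))]
  simp only [mul_one]
  have g : Good (fun p : Z3 => 7 * p.1 ^ 2 - 7 * p.1 + ((1:ℕ):ℤ) * p.1 + (7 * p.2.1 ^ 2 - 7 * p.2.1 + ((3:ℕ):ℤ) * p.2.1 +
    (7 * p.2.2 ^ 2 - 7 * p.2.2 + ((5:ℕ):ℤ) * p.2.2)) + ((2:ℕ):ℤ)) := by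
    refine ⟨fun p => add_nonneg ((g1.prod (g3.prod g5)).nn p) (by norm_num), fun n => ?_⟩
    refine ((g1.prod (g3.prod g5)).fin (n - 2)).subset fun p hp => ?_
    simp only [Set.mem_ofPred_eq] at hp ⊢
    push_cast at hp ⊢
    linarith
  rw [coeff_Th_one g]
  norm_num [BB]

theorem AA_split {N : ℤ} : (AA (7 * N)).ncard =
    {p : Z3 | 7 * p.1 ^ 2 + (7 * p.2.1 ^ 2 + 7 * p.2.2 ^ 2) = N}.ncard + 6 * (BB N).ncard := by
  classical
  rw [Set.ncard_eq_toFinset_card _ (AA_fin _), Finset.card_eq_sum_card_fiberwise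
    (f := fun p : Z3 => p.1 % 7) (t := {0,1,2,3,4,5,6})]
  · have hc : ∀ j : ℤ, ((AA_fin (7 * N)).toFinset.filter (fun p : Z3 => p.1 % 7 = j)).card =
        {p ∈ AA (7 * N) | p.1 % 7 = j}.ncard := by
      intro j
      rw [← Set.ncard_coe_finset]
      congr 1
      ext p
      simp
    simp only [hc]
    have h0 : {p ∈ AA (7 * N) | p.1 % 7 = 0}.ncard =
        {p : Z3 | 7 * p.1 ^ 2 + (7 * p.2.1 ^ 2 + 7 * p.2.2 ^ 2) = N}.ncard := by
      symm
      refine nc (fun p => (7 * p.1, 7 * p.2.1, 7 * p.2.2)) ?_ ?_ ?_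
      · rintro ⟨a, b, c⟩ ⟨a', b', c'⟩ h
        simp only [Prod.mk.injEq] at h ⊢
        omega
      · rintro ⟨a, b, c⟩
        simp only [Set.mem_ofPred_eq, AA]
        constructor
        · exact fun h => ⟨⟨by linear_combination 7 * h, by omega, by omega⟩, by omega⟩
        · rintro ⟨⟨h, -⟩, -⟩
          linarith
      · rintro ⟨x, y, z⟩ h
        simp only [Set.mem_ofPred_eq, AA] at h
        refine ⟨(x / 7, y / 7, z / 7), ?_⟩
        simp only [Prod.mk.injEq, and_true, true_and]
        omega
    have h1 : {p ∈ AA (7 * N) | p.1 % 7 = 1}.ncard = (BB N).ncard := by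
      symm
      refine nc (fun p => (1 - 7 * p.2.2, 2 - 7 * p.2.1, 7 * p.1 - 3)) ?_ ?_ ?_
      · rintro ⟨a, b, c⟩ ⟨a', b', c'⟩ h
        simp only [Prod.mk.injEq] at h ⊢
        omega
      · rintro ⟨a, b, c⟩
        simp only [Set.mem_ofPred_eq, AA, BB]
        constructor
        · exact fun h => ⟨⟨by linear_combination 7 * h, by omega, by omega⟩, by omega⟩
        · rintro ⟨⟨h, -⟩, -⟩
          linarith
      · rintro ⟨x, y, z⟩ h
        simp only [Set.mem_ofPred_eq, AA] at h
        refine ⟨((z + 3) / 7, (2 - y) / 7, (1 - x) / 7), ?_⟩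
        simp only [Prod.mk.injEq, and_true, true_and]
        omega
    have hn : ∀ i j : ℤ, 0 < i → i < 7 → i + j = 7 → {p ∈ AA (7 * N) | p.1 % 7 = i}.ncard =
        {p ∈ AA (7 * N) | p.1 % 7 = j}.ncard := by
      intro i j hi hi' hij
      refine nc (fun p => (-p.1, -p.2.1, -p.2.2)) ?_ ?_ ?_
      · rintro ⟨a, b, c⟩ ⟨a', b', c'⟩ h
        simp only [Prod.mk.injEq] at h ⊢
        omega
      · rintro ⟨a, b, c⟩
        simp only [Set.mem_ofPred_eq, AA, neg_sq]
        constructor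
        · exact fun h => ⟨⟨h.1.1, by omega, by omega⟩, by omega⟩
        · exact fun h => ⟨⟨h.1.1, by omega, by omega⟩, by omega⟩
      · rintro ⟨x, y, z⟩ h
        exact ⟨(-x, -y, -z), by simp⟩
    have hcy : ∀ i j : ℤ, 0 < i → i < 7 → j = 2 * i % 7 → {p ∈ AA (7 * N) | p.1 % 7 = i}.ncard =
        {p ∈ AA (7 * N) | p.1 % 7 = j}.ncard := by
      intro i j hi hi' hij
      refine nc cyc cyc_inj ?_ (fun y _ => ⟨cyc (cyc y), rfl⟩)
      rintro ⟨a, b, c⟩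
      simp only [Set.mem_ofPred_eq, AA, cyc]
      constructor
      · exact fun h => ⟨⟨by linarith [h.1.1], by omega, by omega⟩, by omega⟩
      · exact fun h => ⟨⟨by linarith [h.1.1], by omega, by omega⟩, by omega⟩
    have h2 := hcy 1 2 (by norm_num) (by norm_num) (by norm_num)
    have h4 := hcy 2 4 (by norm_num) (by norm_num) (by norm_num)
    have h6 := hn 1 6 (by norm_num) (by norm_num) (by norm_num)
    have h5 := hn 2 5 (by norm_num) (by norm_num) (by norm_num)
    have h3 := hn 4 3 (by norm_num) (by norm_num) (by norm_num)
    rw [Finset.sum_insert (by decide), Finset.sum_insert (by decide), Finset.sum_insert (by decide),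
      Finset.sum_insert (by decide), Finset.sum_insert (by decide), Finset.sum_insert (by decide),
      Finset.sum_singleton]
    omega
  · intro p _
    simp only [Finset.coe_insert, Finset.coe_singleton, Set.mem_insert_iff, Set.mem_singleton_iff]
    omega

theorem S0_rep {K : ℤ} (h8 : K % 8 = 1) :
    {p : Z3 | p.1 ^ 2 + p.2.1 ^ 2 + p.2.2 ^ 2 = K}.ncard = 3 * rep 1 8 8 0 0 0 K := by
  rw [three (fin3 K)]
  · congr 1
    symm
    refine nc (fun p => (p.1, 2 * (p.2.1 + p.2.2), 2 * (p.2.1 - p.2.2))) ?_ ?_ ?_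
    · rintro ⟨a, b, c⟩ ⟨a', b', c'⟩ h
      simp only [Prod.mk.injEq] at h ⊢
      omega
    · rintro ⟨a, b, c⟩
      simp only [Set.mem_ofPred_eq]
      constructor
      · intro h
        have h' : a ^ 2 + (2 * (b + c)) ^ 2 + (2 * (b - c)) ^ 2 = K := by linear_combination -h
        have := par3 (h' ▸ h8)
        exact ⟨h', by omega⟩
      · rintro ⟨h, _⟩
        linear_combination -h
    · rintro ⟨x, y, z⟩ ⟨h, h1⟩
      simp only [Set.mem_ofPred_eq] at h h1
      have := sq_par x
      have := sq_par y
      have := sq_par z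
      refine ⟨(x, (y + z) / 4, (y - z) / 4), ?_⟩
      simp only [Prod.mk.injEq, and_true, true_and]
      omega
  · rintro ⟨x, y, z⟩
    simp only [cyc, Set.mem_ofPred_eq]
    constructor <;> intro h <;> linarith
  · intro p h
    simp only [Set.mem_ofPred_eq] at h
    rw [h]; exact h8

theorem F_rep {N : ℤ} (h8 : N % 8 = 7) :
    {p : Z3 | p.1 ^ 2 + (p.2.1 ^ 2 + 7 * p.2.2 ^ 2) = N}.ncard = rep 1 14 14 0 0 0 (7 * N) := by
  symm
  trans {p : Z3 | 7 * p.1 ^ 2 + 2 * p.2.1 ^ 2 + 2 * p.2.2 ^ 2 = N}.ncard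
  · symm
    refine nc (fun p => (7 * p.1, p.2.1, p.2.2)) ?_ ?_ ?_
    · rintro ⟨a, b, c⟩ ⟨a', b', c'⟩ h
      simp only [Prod.mk.injEq] at h ⊢
      omega
    · rintro ⟨a, b, c⟩
      simp only [Set.mem_ofPred_eq]
      constructor <;> intro h <;> linarith
    · rintro ⟨x, y, z⟩ h
      simp only [Set.mem_ofPred_eq] at h
      obtain ⟨m, hm⟩ := dvd_sq7 (x := x) (m := N - 2 * y ^ 2 - 2 * z ^ 2) (by linear_combination -h)
      exact ⟨(m, y, z), by rw [hm]⟩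
  · refine nc (fun p => (p.2.1 + p.2.2, p.2.1 - p.2.2, p.1)) ?_ ?_ ?_
    · rintro ⟨a, b, c⟩ ⟨a', b', c'⟩ h
      simp only [Prod.mk.injEq] at h ⊢
      omega
    · rintro ⟨a, b, c⟩
      simp only [Set.mem_ofPred_eq]
      constructor <;> intro h <;> linarith
    · rintro ⟨x, y, z⟩ h
      simp only [Set.mem_ofPred_eq] at h
      have := sq_par x
      have := sq_par y
      have := sq_par z
      refine ⟨(z, (x + y) / 2, (x - y) / 2), ?_⟩
      simp only [Prod.mk.injEq, and_true, true_and]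
      omega

theorem H_rep {N : ℤ} :
    {p : Z3 | p.1 ^ 2 + (2 * p.2.1 ^ 2 + 14 * p.2.2 ^ 2) = N}.ncard = rep 2 7 14 0 0 0 (7 * N) := by
  refine nc (fun p => (7 * p.2.2, p.1, p.2.1)) ?_ ?_ ?_
  · rintro ⟨a, b, c⟩ ⟨a', b', c'⟩ h
    simp only [Prod.mk.injEq] at h ⊢
    omega
  · rintro ⟨a, b, c⟩
    simp only [Set.mem_ofPred_eq]
    constructor <;> intro h <;> linarith
  · rintro ⟨x, y, z⟩ h
    simp only [Set.mem_ofPred_eq] at h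
    obtain ⟨m, hm⟩ := dvd_sq7 (x := x) (m := 4 * N - 4 * y ^ 2 - 8 * z ^ 2 - x ^ 2) (by linear_combination -4 * h)
    exact ⟨(y, z, m), by rw [hm]⟩

theorem main (N : ℕ) (h8 : N % 8 = 7) :
    7 * (if (7 ^ 2 : ℤ) ∣ 7 * N then (rep 1 8 8 0 0 0 (7 * N / 7 ^ 2) : ℤ) else 0) =
      -(rep 1 14 14 0 0 0 (7 * N) : ℤ) - 2 * rep 2 7 14 0 0 0 (7 * N) + 4 * rep 3 5 14 0 0 2 (7 * N) := by
  have h8' : (N : ℤ) % 8 = 7 := by omega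
  have k : 8 * (X ^ 2 * (fr 1 * fr 3 * fr 5)) + 2 * (ph 1 * (pm 2 * pm 14)) =
      ph 7 ^ 3 + ph 1 * (ph 1 * ph 7) := by
    linear_combination (-1) * K - ph 1 * T1
  have k2 := congrArg (coeff N) k
  have e8 : (8 : R) = C 8 := (map_ofNat _ 8).symm
  have e2 : (2 : R) = C 2 := (map_ofNat _ 2).symm
  rw [map_add, map_add, e8, coeff_C_mul, e2, coeff_C_mul, c_ph7, c_F, c_H h8, c_fr,
    F_rep h8', H_rep] at k2
  have k3 := AA_rep (M := 7 * N) (by omega) (by omega)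
  rw [AA_split] at k3
  have k4 : ({p : Z3 | 7 * p.1 ^ 2 + (7 * p.2.1 ^ 2 + 7 * p.2.2 ^ 2) = (N:ℤ)}.ncard : ℤ) =
      3 * (if (7 ^ 2 : ℤ) ∣ 7 * N then (rep 1 8 8 0 0 0 (7 * N / 7 ^ 2) : ℤ) else 0) := by
    split_ifs with h
    · have hk : (N : ℤ) = 7 * (7 * N / 7 ^ 2) := by omega
      have := S0_rep (K := 7 * N / 7 ^ 2) (by omega)
      rw [← Nat.cast_ofNat (n := 3), ← Nat.cast_mul, ← this]
      congr 2
      ext p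
      simp only [Set.mem_ofPred_eq]
      constructor <;> intro h <;> linarith
    · have : {p : Z3 | 7 * p.1 ^ 2 + (7 * p.2.1 ^ 2 + 7 * p.2.2 ^ 2) = (N:ℤ)} = ∅ := by
        ext p
        simp only [Set.mem_ofPred_eq, Set.mem_empty_iff_false, iff_false]
        intro h'
        exact h ⟨p.1 ^ 2 + p.2.1 ^ 2 + p.2.2 ^ 2, by linarith⟩
      rw [this]; simp
  generalize (if (7 ^ 2 : ℤ) ∣ 7 * N then (rep 1 8 8 0 0 0 (7 * N / 7 ^ 2) : ℤ) else 0) = r at *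
  generalize {p : Z3 | 7 * p.1 ^ 2 + (7 * p.2.1 ^ 2 + 7 * p.2.2 ^ 2) = (N:ℤ)}.ncard = s at *
  generalize (BB N).ncard = b at *
  generalize rep 1 14 14 0 0 0 (7 * N) = r1 at *
  generalize rep 2 7 14 0 0 0 (7 * N) = r2 at *
  generalize rep 3 5 14 0 0 2 (7 * N) = r3 at *
  have k5 : 8 * (b : ℤ) + 2 * (-(r2 : ℤ)) = s + r1 := by exact_mod_cast k2
  omega

end T7

theorem thm_1_2_second (M : ℤ) (hM : 0 < M) (h8 : M % 8 = 1) (h7 : 7 ∣ M) :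
    7 * (if (7 ^ 2 : ℤ) ∣ M then (rep 1 8 8 0 0 0 (M / 7 ^ 2) : ℤ) else 0) =
      -(rep 1 14 14 0 0 0 M : ℤ) - 2 * rep 2 7 14 0 0 0 M + 4 * rep 3 5 14 0 0 2 M := by
  obtain ⟨k, rfl⟩ := h7
  obtain ⟨N, rfl⟩ := Int.eq_ofNat_of_zero_le (show 0 ≤ k by omega)
  exact T7.main N (by omega)
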